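/- Let (X,T) be a topological dynamical system and f ∈ C(X,ℝ). Then sup_{x∈X} P(T,f, closure(W^s(x,T)) ∩ closure(W^u(x,T))) = P(T,f). -/

import Mathlib

open Filter Set Topology MeasureTheory

noncomputable section

variable {X : Type*}

/-- Birkhoff sum `f_n(x) = ∑_{j<n} f(T^j x)`. -/
def birk (T : X → X) (f : X → ℝ) (n : ℕ) (x : X) : ℝ :=
  ∑ j ∈ Finset.range n, f (T^[j] x)

/-- `P_n(T,f,δ,K)`: supremum of `∑_{x∈E} exp f_n(x)` over `(n,δ)`-separated
subsets `E ⊆ K`. -/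
def sepPn [MetricSpace X] (T : X → X) (f : X → ℝ) (n : ℕ) (δ : ℝ) (K : Set X) : ℝ :=
  sSup { r : ℝ | ∃ E : Finset X, ↑E ⊆ K ∧
    (∀ x ∈ E, ∀ y ∈ E, x ≠ y → ∃ i < n, δ < dist (T^[i] x) (T^[i] y)) ∧
    r = ∑ x ∈ E, Real.exp (birk T f n x) }

/-- The topological pressure of `T` for the subset `K`:
`P(T,f,K) = lim_{δ→0} limsup_n (1/n) log P_n(T,f,δ,K)`; since the expression is
nonincreasing in `δ`, the limit is the supremum over `δ > 0`. -/
def pres [MetricSpace X] (T : X → X) (f : X → ℝ) (K : Set X) : EReal :=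
  ⨆ (δ : ℝ) (_ : 0 < δ), atTop.limsup fun n : ℕ =>
    ((Real.log (sepPn T f n δ K) / n : ℝ) : EReal)

/-- The `ε`-stable set `W^s_ε(x,T)`. -/
def epsStable [MetricSpace X] (T : X → X) (ε : ℝ) (x : X) : Set X :=
  { y | ∀ n : ℕ, dist (T^[n] x) (T^[n] y) ≤ ε }

/-- The topological pressure of the preimages of the `ε`-stable set of `x`:
`P_s(T,f,x,ε) = lim_{δ→0} limsup_n (1/n) log P_n(T,f,δ,T^{-n}W^s_ε(x,T))`. -/
def Ps [MetricSpace X] (T : X → X) (f : X → ℝ) (x : X) (ε : ℝ) : EReal :=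
  ⨆ (δ : ℝ) (_ : 0 < δ), atTop.limsup fun n : ℕ =>
    ((Real.log (sepPn T f n δ ((T^[n]) ⁻¹' epsStable T ε x)) / n : ℝ) : EReal)

/-- A finite open cover of `X`. -/
def IsOpenCover [TopologicalSpace X] (𝒰 : Finset (Set X)) : Prop :=
  (∀ U ∈ 𝒰, IsOpen U) ∧ ⋃₀ (𝒰 : Set (Set X)) = univ

/-- A finite Borel cover of `X`. -/
def IsBorelCover [MeasurableSpace X] (𝒱 : Finset (Set X)) : Prop :=
  (∀ V ∈ 𝒱, MeasurableSet V) ∧ ⋃₀ (𝒱 : Set (Set X)) = univ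

/-- `𝒱` refines the iterated cover `𝒰_0^{n-1} = ⋁_{i<n} T^{-i}𝒰`. -/
def RefinesIter (T : X → X) (𝒰 : Finset (Set X)) (n : ℕ) (𝒱 : Finset (Set X)) : Prop :=
  ∀ V ∈ 𝒱, ∃ g : Fin n → Set X, (∀ i, g i ∈ 𝒰) ∧ V ⊆ ⋂ i : Fin n, (T^[(i : ℕ)]) ⁻¹' g i

/-- `P_n(T,f,𝒰,K)`: infimum over finite Borel covers `𝒱` refining `𝒰_0^{n-1}` of
`∑_{V∈𝒱} sup_{x ∈ V∩K} exp f_n(x)` (an empty summand contributes `0`, which is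
`Real.sSup ∅`). -/
def covPn [MeasurableSpace X] (T : X → X) (f : X → ℝ) (𝒰 : Finset (Set X)) (n : ℕ)
    (K : Set X) : ℝ :=
  sInf { r : ℝ | ∃ 𝒱 : Finset (Set X), IsBorelCover 𝒱 ∧ RefinesIter T 𝒰 n 𝒱 ∧
    r = ∑ V ∈ 𝒱, sSup ((fun x => Real.exp (birk T f n x)) '' (V ∩ K)) }

/-- A finite Borel partition of `X`. -/
def IsFinPartition [MeasurableSpace X] (α : Finset (Set X)) : Prop :=
  (∀ A ∈ α, MeasurableSet A) ∧ ⋃₀ (α : Set (Set X)) = univ ∧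
    (α : Set (Set X)).Pairwise Disjoint

/-- `H_μ(⋁_{i<n} T^{-i}α)`, computed over all atoms `⋂_{i<n} T^{-i} A_i`. -/
def dynH [MeasurableSpace X] (μ : Measure X) (T : X → X) (α : Finset (Set X)) (n : ℕ) : ℝ :=
  ∑ g : Fin n → α, Real.negMulLog ((μ (⋂ i : Fin n, (T^[(i : ℕ)]) ⁻¹' (g i : Set X))).toReal)

/-- `h_μ(T,α) = lim_n (1/n) H_μ(α_0^{n-1})`, which for an invariant measure equals
the infimum of `(1/n) H_μ(α_0^{n-1})` over `n ≥ 1`. -/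
def entPart [MeasurableSpace X] (μ : Measure X) (T : X → X) (α : Finset (Set X)) : ℝ :=
  ⨅ n : ℕ, dynH μ T α (n + 1) / (n + 1 : ℝ)

/-- The measure-theoretic entropy `h_μ(T)`. -/
def mEnt [MeasurableSpace X] (μ : Measure X) (T : X → X) : EReal :=
  ⨆ (α : Finset (Set X)) (_ : IsFinPartition α), ((entPart μ T α : ℝ) : EReal)

/-- The measure-theoretic pressure `P_μ(T,f) = h_μ(T) + ∫ f dμ`. -/
def mPres [MeasurableSpace X] (μ : Measure X) (T : X → X) (f : X → ℝ) : EReal :=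
  mEnt μ T + ((∫ x, f x ∂μ : ℝ) : EReal)

/-- The stable set `W^s(x,T)`. -/
def stableSet [MetricSpace X] (T : X → X) (x : X) : Set X :=
  { y | Tendsto (fun n : ℕ => dist (T^[n] x) (T^[n] y)) atTop (𝓝 0) }

/-- A Cantor set: a nonempty compact perfect totally disconnected set. -/
def IsCantorSet [TopologicalSpace X] (C : Set X) : Prop :=
  C.Nonempty ∧ IsCompact C ∧ Perfect C ∧ IsTotallyDisconnected C

/-- A weakly mixing set for `T`. -/
def IsWeaklyMixingSet [TopologicalSpace X] (T : X → X) (A : Set X) : Prop :=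
  A.Nonempty ∧ IsClosed A ∧
  ∃ B : Set X, B ⊆ A ∧
    (∃ C : ℕ → Set X, (∀ n, IsCantorSet (C n)) ∧ B = ⋃ n, C n) ∧
    closure B = A ∧
    ∀ C : Set X, C ⊆ B → IsCantorSet C →
      ∀ g : C → X, Continuous g → (∀ c : C, g c ∈ A) →
        ∃ φ : ℕ → ℕ, StrictMono φ ∧
          ∀ c : C, Tendsto (fun i => T^[φ i] (c : X)) atTop (𝓝 (g c))

section Polymatroid

open Classical in
/-- A normalized monotone submodular function on finite subsets of `M`. -/
structure IsPolymatroid {M : Type*} (H : Finset M → ℝ) : Prop where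
  empty : H ∅ = 0
  mono : ∀ S S' : Finset M, S ⊆ S' → H S ≤ H S'
  submod : ∀ S W W' : Finset M, W ⊆ W' → H (S ∪ W') + H W ≤ H (S ∪ W) + H W'

open Classical in
/-- The conditional rank `H(S | 𝒲)` of a finite set given an arbitrary set. -/
def condH {M : Type*} (H : Finset M → ℝ) (S : Finset M) (𝒲 : Set M) : ℝ :=
  ⨅ W : {W : Finset M // (W : Set M) ⊆ 𝒲}, (H (S ∪ W) - H W)

/-- The closure of a set: the elements of conditional rank zero. -/
def clH {M : Type*} (H : Finset M → ℝ) (𝒲 : Set M) : Set M := {a | condH H {a} 𝒲 = 0}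

open Classical in
/-- The block `⋃_{i<n} τ^i S`. -/
def blk {M : Type*} (τ : Equiv.Perm M) (S : Finset M) (n : ℕ) : Finset M :=
  (Finset.range n).biUnion fun i => S.image (τ ^ i)

/-- The tail `⋃_{i≥n} τ^i S`. -/
def fut {M : Type*} (τ : Equiv.Perm M) (S : Set M) (n : ℕ) : Set M :=
  {x | ∃ m : ℕ, n ≤ m ∧ ∃ b ∈ S, x = (τ ^ m) b}

/-- The orbit `⋃_{i∈ℤ} τ^i S`. -/
def orb {M : Type*} (τ : Equiv.Perm M) (S : Set M) : Set M :=
  {x | ∃ m : ℤ, ∃ b ∈ S, x = (τ ^ m) b}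

/-- The entropy rate of `S` along `τ`. -/
def rate {M : Type*} (H : Finset M → ℝ) (τ : Equiv.Perm M) (S : Finset M) : ℝ :=
  condH H S (fut τ S 1)

open Classical

variable {M : Type*} {H : Finset M → ℝ} {τ : Equiv.Perm M}

namespace IsPolymatroid

lemma condH_term_nonneg (hH : IsPolymatroid H) (S W : Finset M) : 0 ≤ H (S ∪ W) - H W :=
  sub_nonneg.2 (hH.mono _ _ Finset.subset_union_right)

lemma bddBelow (hH : IsPolymatroid H) (S : Finset M) (𝒲 : Set M) :
    BddBelow (range fun W : {W : Finset M // (W : Set M) ⊆ 𝒲} => H (S ∪ W) - H W) :=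
  ⟨0, by rintro _ ⟨W, rfl⟩; exact hH.condH_term_nonneg S W⟩

lemma nonempty_fin (𝒲 : Set M) : Nonempty {W : Finset M // (W : Set M) ⊆ 𝒲} :=
  ⟨⟨∅, by simp⟩⟩

lemma condH_le (hH : IsPolymatroid H) (S : Finset M) {W : Finset M} {𝒲 : Set M}
    (hW : (W : Set M) ⊆ 𝒲) : condH H S 𝒲 ≤ H (S ∪ W) - H W :=
  ciInf_le (hH.bddBelow S 𝒲) ⟨W, hW⟩

lemma le_condH {S : Finset M} {𝒲 : Set M} {c : ℝ}
    (h : ∀ W : Finset M, (W : Set M) ⊆ 𝒲 → c ≤ H (S ∪ W) - H W) : c ≤ condH H S 𝒲 :=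
  have := nonempty_fin 𝒲
  le_ciInf fun W => h W.1 W.2

lemma exists_condH_lt (S : Finset M) (𝒲 : Set M) {ε : ℝ} (hε : 0 < ε) :
    ∃ W : Finset M, (W : Set M) ⊆ 𝒲 ∧ H (S ∪ W) - H W < condH H S 𝒲 + ε := by
  have := nonempty_fin 𝒲
  obtain ⟨W, hW⟩ := exists_lt_of_ciInf_lt (lt_add_of_pos_right (condH H S 𝒲) hε)
  exact ⟨W.1, W.2, hW⟩

lemma condH_nonneg (hH : IsPolymatroid H) (S : Finset M) (𝒲 : Set M) : 0 ≤ condH H S 𝒲 :=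
  le_condH fun W _ => hH.condH_term_nonneg S W

lemma condH_anti (hH : IsPolymatroid H) (S : Finset M) {𝒲 𝒲' : Set M} (h : 𝒲 ⊆ 𝒲') :
    condH H S 𝒲' ≤ condH H S 𝒲 :=
  le_condH fun _ hW => hH.condH_le S (hW.trans h)

lemma condH_mono (hH : IsPolymatroid H) {S S' : Finset M} (h : S ⊆ S') (𝒲 : Set M) :
    condH H S 𝒲 ≤ condH H S' 𝒲 :=
  le_condH fun _ hW => (hH.condH_le S hW).trans
    (sub_le_sub_right (hH.mono _ _ (Finset.union_subset_union_left h)) _)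

lemma condH_coe (hH : IsPolymatroid H) (S W : Finset M) :
    condH H S (W : Set M) = H (S ∪ W) - H W := by
  refine le_antisymm (hH.condH_le S subset_rfl) (le_condH fun V hV => ?_)
  have := hH.submod S V W (by exact_mod_cast hV)
  linarith

lemma condH_empty (hH : IsPolymatroid H) (S : Finset M) : condH H S ∅ = H S := by
  have := hH.condH_coe S ∅
  simpa [hH.empty] using this

lemma condH_le_self (hH : IsPolymatroid H) (S : Finset M) (𝒲 : Set M) : condH H S 𝒲 ≤ H S :=
  (hH.condH_anti S (empty_subset 𝒲)).trans_eq (hH.condH_empty S)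

lemma condH_union (hH : IsPolymatroid H) (S S' : Finset M) (𝒲 : Set M) :
    condH H (S ∪ S') 𝒲 = condH H S 𝒲 + condH H S' (𝒲 ∪ S) := by
  apply le_antisymm
  · refine le_of_forall_pos_le_add fun ε hε => ?_
    obtain ⟨W₁, h₁, h₁'⟩ := exists_condH_lt (H := H) S 𝒲 (half_pos hε)
    obtain ⟨W₂, h₂, h₂'⟩ := exists_condH_lt (H := H) S' (𝒲 ∪ S) (half_pos hε)
    set W := W₁ ∪ W₂.filter (· ∈ 𝒲) with hW
    have hW𝒲 : (W : Set M) ⊆ 𝒲 := by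
      intro x hx
      simp only [hW, Finset.coe_union, Finset.coe_filter, mem_union, Finset.mem_coe,
        mem_ofPred_eq] at hx
      rcases hx with hx | hx
      exacts [h₁ hx, hx.2]
    have e₁ := hH.submod S W₁ W Finset.subset_union_left
    have e₂ := hH.submod S' W₂ (S ∪ W) (by
      intro x hx
      have := h₂ hx
      simp only [hW, Finset.mem_union, Finset.mem_filter]
      rcases this with h | h
      · exact Or.inr (Or.inr ⟨hx, h⟩)
      · exact Or.inl (by simpa using h))
    have e₃ := hH.condH_le (S ∪ S') hW𝒲
    have : S' ∪ (S ∪ W) = S ∪ S' ∪ W := by ext; simp; tauto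
    rw [this] at e₂
    linarith
  · refine le_condH fun W hW => ?_
    have e₁ := hH.condH_le S hW
    have e₂ := hH.condH_le S' (W := S ∪ W) (𝒲 := 𝒲 ∪ S) (by
      rw [Finset.coe_union, union_comm]; exact union_subset_union_left _ hW)
    have : S' ∪ (S ∪ W) = S ∪ S' ∪ W := by ext; simp; tauto
    rw [this] at e₂
    linarith

lemma condH_union_le (hH : IsPolymatroid H) (S S' : Finset M) (𝒲 : Set M) :
    condH H (S ∪ S') 𝒲 ≤ condH H S 𝒲 + condH H S' 𝒲 := by
  rw [hH.condH_union]
  gcongr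
  exact hH.condH_anti _ subset_union_left

lemma union_le (hH : IsPolymatroid H) (S S' : Finset M) : H (S ∪ S') ≤ H S + H S' := by
  simpa [hH.condH_empty] using hH.condH_union_le S S' ∅

lemma condH_empty_left (hH : IsPolymatroid H) (𝒲 : Set M) : condH H ∅ 𝒲 = 0 :=
  le_antisymm ((hH.condH_le_self ∅ 𝒲).trans_eq hH.empty) (hH.condH_nonneg _ _)

lemma le_sum_singleton (hH : IsPolymatroid H) (S : Finset M) : H S ≤ ∑ a ∈ S, H {a} := by
  induction S using Finset.induction_on with
  | empty => simp [hH.empty]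
  | insert a S ha ih =>
    rw [Finset.sum_insert ha, Finset.insert_eq]
    exact (hH.union_le _ _).trans (by gcongr)

lemma condH_eq_zero_of_subset_clH (hH : IsPolymatroid H) {S : Finset M} {𝒲 : Set M}
    (h : (S : Set M) ⊆ clH H 𝒲) : condH H S 𝒲 = 0 := by
  induction S using Finset.induction_on with
  | empty => exact hH.condH_empty_left _
  | insert a S ha ih =>
    rw [Finset.coe_insert, insert_subset_iff] at h
    refine le_antisymm ?_ (hH.condH_nonneg _ _)
    rw [Finset.insert_eq]
    refine (hH.condH_union_le _ _ _).trans ?_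
    rw [ih h.2, show condH H {a} 𝒲 = 0 from h.1, add_zero]

lemma subset_clH (hH : IsPolymatroid H) (𝒲 : Set M) : 𝒲 ⊆ clH H 𝒲 := by
  intro a ha
  refine le_antisymm ?_ (hH.condH_nonneg _ _)
  simpa using hH.condH_le {a} (W := {a}) (𝒲 := 𝒲) (by simpa using ha)

lemma clH_mono (hH : IsPolymatroid H) {𝒲 𝒲' : Set M} (h : 𝒲 ⊆ 𝒲') : clH H 𝒲 ⊆ clH H 𝒲' :=
  fun _ ha => le_antisymm ((hH.condH_anti _ h).trans_eq ha) (hH.condH_nonneg _ _)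

/-- Conditioning on the closure is the same as conditioning on the set. -/
lemma condH_clH (hH : IsPolymatroid H) (S : Finset M) (𝒲 : Set M) :
    condH H S (clH H 𝒲) = condH H S 𝒲 := by
  refine le_antisymm (hH.condH_anti S (hH.subset_clH 𝒲)) (le_condH fun W hW => ?_)
  rw [← hH.condH_coe]
  calc condH H S 𝒲 ≤ condH H (W ∪ S) 𝒲 := hH.condH_mono Finset.subset_union_right _
    _ = condH H S (𝒲 ∪ W) := by
        rw [hH.condH_union, hH.condH_eq_zero_of_subset_clH hW, zero_add]
    _ ≤ condH H S W := hH.condH_anti S subset_union_right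

lemma clH_clH (hH : IsPolymatroid H) (𝒲 : Set M) : clH H (clH H 𝒲) = clH H 𝒲 := by
  ext a
  simp only [clH, mem_ofPred_eq]
  rw [show {a | condH H {a} 𝒲 = 0} = clH H 𝒲 from rfl, hH.condH_clH]

lemma exists_condH_le_of_monotone (hH : IsPolymatroid H) (S : Finset M) {𝒱 : ℕ → Set M}
    (hm : Monotone 𝒱) {ε : ℝ} (hε : 0 < ε) : ∃ n, condH H S (𝒱 n) < condH H S (⋃ n, 𝒱 n) + ε := by
  obtain ⟨W, hW, hW'⟩ := exists_condH_lt (H := H) S (⋃ n, 𝒱 n) hε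
  have : ∃ n, (W : Set M) ⊆ 𝒱 n :=
    hm.directed_le.exists_mem_subset_of_finset_subset_biUnion (by simpa using hW)
  obtain ⟨n, hn⟩ := this
  exact ⟨n, (hH.condH_le S hn).trans_lt hW'⟩

end IsPolymatroid

lemma image_image_perm (σ ρ : Equiv.Perm M) (S : Finset M) :
    (S.image ρ).image σ = S.image (σ * ρ) := by
  rw [Finset.image_image]; rfl

lemma condH_image (hτ : ∀ S : Finset M, H (S.image τ) = H S) (S : Finset M) (𝒲 : Set M) :
    condH H (S.image τ) (τ '' 𝒲) = condH H S 𝒲 := by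
  have key : ∀ W : Finset M, H (S.image τ ∪ W.image τ) - H (W.image τ) = H (S ∪ W) - H W := by
    intro W; rw [← Finset.image_union, hτ, hτ]
  unfold condH
  refine (Equiv.iInf_congr ((τ.finsetCongr).subtypeEquiv ?_) ?_).symm
  · intro W
    simp [Equiv.finsetCongr]
  · intro W
    rw [← key]
    simp [Equiv.finsetCongr, Finset.map_eq_image]

lemma rank_image_pow (hτ : ∀ S : Finset M, H (S.image τ) = H S) (n : ℕ) (S : Finset M) :
    H (S.image (τ ^ n)) = H S := by
  induction n generalizing S with
  | zero => simp
  | succ n ih => rw [pow_succ, ← image_image_perm, ih, hτ]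

lemma rank_image_inv (hτ : ∀ S : Finset M, H (S.image τ) = H S) (S : Finset M) :
    H (S.image (τ⁻¹ : Equiv.Perm M)) = H S := by
  rw [← hτ, image_image_perm]; simp

lemma rank_image_zpow (hτ : ∀ S : Finset M, H (S.image τ) = H S) (n : ℤ) (S : Finset M) :
    H (S.image (τ ^ n)) = H S := by
  obtain ⟨n, rfl | rfl⟩ := n.eq_nat_or_neg
  · simpa using rank_image_pow hτ n S
  · have : ∀ S : Finset M, H (S.image (τ ^ n)) = H S := rank_image_pow hτ n
    simpa using rank_image_inv this S

lemma mem_blk {S : Finset M} {n : ℕ} {x : M} :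
    x ∈ blk τ S n ↔ ∃ i < n, ∃ b ∈ S, (τ ^ i) b = x := by
  simp [blk]

lemma mem_fut {S : Set M} {n : ℕ} {x : M} :
    x ∈ fut τ S n ↔ ∃ m, n ≤ m ∧ ∃ b ∈ S, (τ ^ m) b = x := by
  simp only [fut, mem_ofPred_eq, eq_comm]

lemma blk_zero (S : Finset M) : blk τ S 0 = ∅ := by simp [blk]

lemma blk_add (S : Finset M) (m n : ℕ) :
    blk τ S (m + n) = blk τ S m ∪ (blk τ S n).image (τ ^ m) := by
  ext x
  simp only [Finset.mem_union, Finset.mem_image, mem_blk]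
  constructor
  · rintro ⟨i, hi, b, hb, rfl⟩
    by_cases him : i < m
    · exact Or.inl ⟨i, him, b, hb, rfl⟩
    · refine Or.inr ⟨_, ⟨i - m, by omega, b, hb, rfl⟩, ?_⟩
      rw [← Equiv.Perm.mul_apply, ← pow_add]
      congr 2; omega
  · rintro (⟨i, hi, b, hb, rfl⟩ | ⟨_, ⟨i, hi, b, hb, rfl⟩, rfl⟩)
    · exact ⟨i, by omega, b, hb, rfl⟩
    · exact ⟨m + i, by omega, b, hb, by rw [pow_add]; rfl⟩

lemma blk_one (S : Finset M) : blk τ S 1 = S := by simp [blk]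

lemma blk_succ (S : Finset M) (n : ℕ) : blk τ S (n + 1) = S ∪ (blk τ S n).image τ := by
  rw [add_comm, blk_add, blk_one, pow_one]

lemma blk_mono (S : Finset M) : Monotone (blk τ S) := fun m n h x => by
  simp only [mem_blk]
  rintro ⟨i, hi, b⟩
  exact ⟨i, hi.trans_le h, b⟩

lemma blk_union (S S' : Finset M) (n : ℕ) : blk τ (S ∪ S') n = blk τ S n ∪ blk τ S' n := by
  ext x
  simp only [Finset.mem_union, mem_blk]
  grind

lemma image_fut (S : Set M) (n : ℕ) : τ '' fut τ S n = fut τ S (n + 1) := by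
  ext x
  simp only [mem_image, mem_fut]
  constructor
  · rintro ⟨_, ⟨m, hm, b, hb, rfl⟩, rfl⟩
    exact ⟨m + 1, by omega, b, hb, by rw [pow_succ']; rfl⟩
  · rintro ⟨m, hm, b, hb, rfl⟩
    exact ⟨_, ⟨m - 1, by omega, b, hb, rfl⟩, by
      rw [← Equiv.Perm.mul_apply, ← pow_succ']; congr 2; omega⟩

lemma fut_anti (S : Set M) : Antitone (fut τ S) := fun m n h x => by
  simp only [mem_fut]
  rintro ⟨i, hi, b⟩
  exact ⟨i, h.trans hi, b⟩

lemma fut_mono {S S' : Set M} (h : S ⊆ S') (n : ℕ) : fut τ S n ⊆ fut τ S' n := fun x => by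
  simp only [mem_fut]
  rintro ⟨i, hi, b, hb, e⟩
  exact ⟨i, hi, b, h hb, e⟩

lemma fut_union (S S' : Set M) (n : ℕ) : fut τ (S ∪ S') n = fut τ S n ∪ fut τ S' n := by
  ext x
  simp only [mem_union, mem_fut]
  grind

lemma fut_succ_union_blk (S : Finset M) (n : ℕ) :
    fut τ (S : Set M) (n + 1) ∪ ((blk τ S n).image τ : Finset M) = fut τ S 1 := by
  ext x
  simp only [mem_union, mem_fut, Finset.mem_coe, Finset.mem_image, mem_blk]
  constructor
  · rintro (⟨m, hm, b, hb, rfl⟩ | ⟨_, ⟨i, hi, b, hb, rfl⟩, rfl⟩)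
    · exact ⟨m, by omega, b, hb, rfl⟩
    · exact ⟨i + 1, by omega, b, hb, by rw [pow_succ']; rfl⟩
  · rintro ⟨m, hm, b, hb, rfl⟩
    by_cases h : n + 1 ≤ m
    · exact Or.inl ⟨m, h, b, hb, rfl⟩
    · exact Or.inr ⟨_, ⟨m - 1, by omega, b, hb, rfl⟩, by
        rw [← Equiv.Perm.mul_apply, ← pow_succ']; congr 2; omega⟩

lemma orb_mono {S S' : Set M} (h : S ⊆ S') : orb τ S ⊆ orb τ S' := by
  rintro _ ⟨m, b, hb, rfl⟩
  exact ⟨m, b, h hb, rfl⟩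

lemma image_orb (S : Set M) : τ '' orb τ S = orb τ S := by
  ext x
  constructor
  · rintro ⟨_, ⟨m, b, hb, rfl⟩, rfl⟩
    exact ⟨m + 1, b, hb, by rw [add_comm, zpow_add, zpow_one]; rfl⟩
  · rintro ⟨m, b, hb, rfl⟩
    exact ⟨(τ ^ (m - 1)) b, ⟨m - 1, b, hb, rfl⟩, by
      rw [← Equiv.Perm.mul_apply, ← zpow_one_add]; simp⟩

end Polymatroid

section PolymatroidDynamics

open Classical

variable {M : Type*} {H : Finset M → ℝ} {τ : Equiv.Perm M}

lemma le_of_forall_mul_le_add {r c : ℝ}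
    (h : ∀ ε > 0, ∃ C : ℝ, ∀ n : ℕ, n * r ≤ n * (c + ε) + C) : r ≤ c := by
  refine le_of_forall_pos_le_add fun ε hε => ?_
  obtain ⟨C, hC⟩ := h (ε / 2) (half_pos hε)
  by_contra! hlt
  obtain ⟨n, hn⟩ := exists_nat_gt (C / (ε / 2))
  have h1 := hC n
  rw [div_lt_iff₀ (half_pos hε)] at hn
  have : (n : ℝ) * (c + ε) ≤ n * r := by gcongr
  nlinarith

lemma image_zpow_fut_subset (S : Set M) (m : ℤ) {n k : ℕ} (h : (k : ℤ) ≤ n + m) :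
    (τ ^ m : Equiv.Perm M) '' fut τ S n ⊆ fut τ S k := by
  rintro _ ⟨_, ⟨i, hi, b, hb, rfl⟩, rfl⟩
  refine ⟨(m + i).toNat, by omega, b, hb, ?_⟩
  rw [← Equiv.Perm.mul_apply, ← zpow_natCast, ← zpow_natCast, ← zpow_add]
  congr 2; omega

lemma blk_image_pow (S : Finset M) (m n : ℕ) :
    blk τ (S.image (τ ^ m)) n = (blk τ S n).image (τ ^ m) := by
  ext x
  simp only [mem_blk, Finset.mem_image]
  constructor
  · rintro ⟨i, hi, _, ⟨b, hb, rfl⟩, rfl⟩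
    exact ⟨_, ⟨i, hi, b, hb, rfl⟩, by
      rw [← Equiv.Perm.mul_apply, ← Equiv.Perm.mul_apply, ← pow_add, ← pow_add, add_comm]⟩
  · rintro ⟨_, ⟨i, hi, b, hb, rfl⟩, rfl⟩
    exact ⟨i, hi, _, ⟨b, hb, rfl⟩, by
      rw [← Equiv.Perm.mul_apply, ← Equiv.Perm.mul_apply, ← pow_add, ← pow_add, add_comm]⟩

lemma blk_inv (S : Finset M) (n : ℕ) :
    (blk τ⁻¹ S n).image (τ ^ (n - 1)) = blk τ S n := by
  ext x
  simp only [mem_blk, Finset.mem_image]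
  constructor
  · rintro ⟨_, ⟨i, hi, b, hb, rfl⟩, rfl⟩
    refine ⟨n - 1 - i, by omega, b, hb, ?_⟩
    rw [← Equiv.Perm.mul_apply, inv_pow, ← pow_sub _ (by omega)]
  · rintro ⟨i, hi, b, hb, rfl⟩
    refine ⟨_, ⟨n - 1 - i, by omega, b, hb, rfl⟩, ?_⟩
    rw [← Equiv.Perm.mul_apply, inv_pow, ← pow_sub _ (by omega)]
    congr 2; omega

lemma exists_subset_blk_of_subset_fut {S W : Finset M} (h : (W : Set M) ⊆ fut τ (S : Set M) 1) :
    ∃ q, W ⊆ (blk τ S q).image τ := by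
  induction W using Finset.induction_on with
  | empty => exact ⟨0, by simp⟩
  | insert a W ha ih =>
    rw [Finset.coe_insert, insert_subset_iff] at h
    obtain ⟨q, hq⟩ := ih h.2
    obtain ⟨m, hm, b, hb, rfl⟩ := h.1
    refine ⟨max q m, Finset.insert_subset ?_ (hq.trans
      (Finset.image_subset_image (blk_mono _ (le_max_left _ _))))⟩
    simp only [Finset.mem_image, mem_blk]
    exact ⟨_, ⟨m - 1, by omega, b, hb, rfl⟩, by
      rw [← Equiv.Perm.mul_apply, ← pow_succ']; congr 2; omega⟩

lemma exists_subset_blk_of_subset_orb {S W : Finset M} (h : (W : Set M) ⊆ orb τ (S : Set M)) :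
    ∃ L : ℕ, W.image (τ ^ L) ⊆ blk τ S (2 * L + 1) := by
  have key : ∃ L : ℕ, ∀ x ∈ W, ∃ m : ℤ, |m| ≤ L ∧ ∃ b ∈ S, x = (τ ^ m) b := by
    induction W using Finset.induction_on with
    | empty => exact ⟨0, by simp⟩
    | insert a W ha ih =>
      rw [Finset.coe_insert, insert_subset_iff] at h
      obtain ⟨q, hq⟩ := ih h.2
      obtain ⟨m, b, hb, hab⟩ := h.1
      refine ⟨max q m.natAbs, fun x hx => ?_⟩
      rcases Finset.mem_insert.1 hx with rfl | hx
      · exact ⟨m, by simp, b, hb, hab⟩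
      · obtain ⟨m', hm', b', hb', e⟩ := hq x hx
        exact ⟨m', by push_cast; exact hm'.trans (le_max_left _ _), b', hb', e⟩
  obtain ⟨L, hL⟩ := key
  refine ⟨L, fun x hx => ?_⟩
  obtain ⟨y, hy, rfl⟩ := Finset.mem_image.1 hx
  obtain ⟨m, hm, b, hb, rfl⟩ := hL y hy
  rw [abs_le] at hm
  refine mem_blk.2 ⟨(L + m).toNat, by omega, b, hb, ?_⟩
  rw [← Equiv.Perm.mul_apply, ← zpow_natCast, ← zpow_natCast, ← zpow_add]
  congr 2; omega

namespace IsPolymatroid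

lemma condH_blk_succ (hH : IsPolymatroid H) (hτ : ∀ S : Finset M, H (S.image τ) = H S)
    (Y : Finset M) (𝒱 : Set M) (n : ℕ) :
    condH H (blk τ Y (n + 1)) (τ '' 𝒱) =
      condH H (blk τ Y n) 𝒱 + condH H Y (τ '' 𝒱 ∪ ((blk τ Y n).image τ : Finset M)) := by
  rw [blk_succ, Finset.union_comm, hH.condH_union, condH_image hτ]

lemma condH_blk_fut (hH : IsPolymatroid H) (hτ : ∀ S : Finset M, H (S.image τ) = H S)
    (Y : Finset M) {𝒰 : Set M} (h𝒰 : τ '' 𝒰 = 𝒰) (n : ℕ) :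
    condH H (blk τ Y n) (𝒰 ∪ fut τ Y n) = n * condH H Y (𝒰 ∪ fut τ Y 1) := by
  induction n with
  | zero => simp [blk_zero, hH.condH_empty_left]
  | succ n ih =>
    have e : 𝒰 ∪ fut τ (Y : Set M) (n + 1) = τ '' (𝒰 ∪ fut τ Y n) := by
      rw [image_union, h𝒰, image_fut]
    rw [e, hH.condH_blk_succ hτ, ih, ← e, union_assoc, fut_succ_union_blk]
    push_cast; ring

lemma rate_nonneg (hH : IsPolymatroid H) (Y : Finset M) : 0 ≤ rate H τ Y := hH.condH_nonneg _ _

lemma mul_rate_le (hH : IsPolymatroid H) (hτ : ∀ S : Finset M, H (S.image τ) = H S)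
    (Y : Finset M) (n : ℕ) : n * rate H τ Y ≤ H (blk τ Y n) := by
  have := hH.condH_blk_fut hτ Y (𝒰 := ∅) (by simp) n
  simp only [empty_union] at this
  rw [rate, ← this]
  exact hH.condH_le_self _ _

lemma rank_blk_le (hH : IsPolymatroid H) (hτ : ∀ S : Finset M, H (S.image τ) = H S)
    (Y : Finset M) {ε : ℝ} (hε : 0 < ε) :
    ∃ C, 0 ≤ C ∧ ∀ n : ℕ, H (blk τ Y n) ≤ n * (rate H τ Y + ε) + C := by
  obtain ⟨W, hW, hW'⟩ := exists_condH_lt (H := H) Y (fut τ Y 1) hε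
  obtain ⟨q, hq⟩ := exists_subset_blk_of_subset_fut hW
  have hr : 0 ≤ rate H τ Y + ε := add_nonneg (hH.rate_nonneg Y) hε.le
  have hpos : ∀ S : Finset M, 0 ≤ H S := fun S => hH.empty ▸ hH.mono _ _ (Finset.empty_subset S)
  refine ⟨H (blk τ Y q), hpos _, fun n => ?_⟩
  rcases le_total n q with h | h
  · have := hH.mono _ _ (blk_mono (τ := τ) Y h)
    have : 0 ≤ n * (rate H τ Y + ε) := by positivity
    linarith
  · induction n, h using Nat.le_induction with
    | base =>
      have : 0 ≤ q * (rate H τ Y + ε) := by positivity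
      linarith
    | succ n hn ih =>
      have h1 := hH.submod Y W ((blk τ Y n).image τ)
        (hq.trans (Finset.image_subset_image (blk_mono _ hn)))
      rw [hτ] at h1
      rw [blk_succ]
      unfold rate at *
      push_cast
      linarith

lemma rate_le_of_rank_blk_le (hH : IsPolymatroid H) (hτ : ∀ S : Finset M, H (S.image τ) = H S)
    {Y : Finset M} {c : ℝ} (h : ∀ ε > 0, ∃ C : ℝ, ∀ n : ℕ, H (blk τ Y n) ≤ n * (c + ε) + C) :
    rate H τ Y ≤ c :=
  le_of_forall_mul_le_add fun ε hε => by
    obtain ⟨C, hC⟩ := h ε hε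
    exact ⟨C, fun n => (hH.mul_rate_le hτ Y n).trans (hC n)⟩

lemma rate_inv_eq_zero (hH : IsPolymatroid H) (hτ : ∀ S : Finset M, H (S.image τ) = H S)
    {Y : Finset M} (h : rate H τ⁻¹ Y = 0) : rate H τ Y = 0 := by
  refine le_antisymm (hH.rate_le_of_rank_blk_le hτ fun ε hε => ?_) (hH.rate_nonneg _)
  obtain ⟨C, -, hC⟩ := hH.rank_blk_le (τ := τ⁻¹) (rank_image_inv hτ) Y hε
  refine ⟨C, fun n => ?_⟩
  rw [← blk_inv, rank_image_pow hτ, ← h]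
  exact hC n

lemma condH_blk_blk_le (hH : IsPolymatroid H) (hτ : ∀ S : Finset M, H (S.image τ) = H S)
    (S W : Finset M) (m n K : ℕ) :
    condH H (blk τ S (m * n)) (blk τ W (m * n + K)) ≤
      n * condH H (blk τ S m) (blk τ W K) := by
  induction n with
  | zero => simp [blk_zero, hH.condH_empty_left]
  | succ n ih =>
    have e : m * (n + 1) = m + m * n := by ring
    rw [e, blk_add]
    refine (hH.condH_union_le _ _ _).trans ?_
    have h1 : condH H (blk τ S m) (blk τ W (m + m * n + K)) ≤ condH H (blk τ S m) (blk τ W K) :=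
      hH.condH_anti _ (by exact_mod_cast blk_mono (τ := τ) W (by omega))
    have h2 : condH H ((blk τ S (m * n)).image (τ ^ m)) (blk τ W (m + m * n + K)) ≤
        condH H (blk τ S (m * n)) (blk τ W (m * n + K)) := by
      rw [← condH_image (τ := τ ^ m) (rank_image_pow hτ m) (blk τ S (m * n)) (blk τ W (m * n + K))]
      refine hH.condH_anti _ ?_
      rw [← Finset.coe_image, add_assoc, blk_add (m := m)]
      exact Finset.coe_subset.2 Finset.subset_union_right
    rw [Nat.cast_succ]
    linarith

/-- A set whose orbit lies in the closure of `𝒵` contributes its rate on top of `H(Y | 𝒵)`. -/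
lemma rate_add_condH_le (hH : IsPolymatroid H) (hτ : ∀ S : Finset M, H (S.image τ) = H S)
    {γ Y : Finset M} {𝒵 : Set M} (hγ : orb τ (γ : Set M) ⊆ clH H 𝒵)
    (hY : fut τ (Y : Set M) 1 ⊆ clH H 𝒵) :
    rate H τ γ + condH H Y 𝒵 ≤ rate H τ Y + condH H γ (orb τ Y) := by
  refine le_of_forall_mul_le_add fun ε hε => ?_
  obtain ⟨W, hW, hW'⟩ := exists_condH_lt (H := H) γ (orb τ Y) (half_pos hε)
  obtain ⟨L, hL⟩ := exists_subset_blk_of_subset_orb hW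
  set K := 2 * L + 1 with hK
  set γ' := γ.image (τ ^ L)
  obtain ⟨C, -, hC⟩ := hH.rank_blk_le hτ Y (half_pos hε)
  have hγ' : condH H γ' (blk τ Y K) ≤ condH H γ (orb τ Y) + ε / 2 := by
    calc condH H γ' (blk τ Y K) ≤ condH H γ' (W.image (τ ^ L) : Finset M) :=
          hH.condH_anti _ (by exact_mod_cast hL)
      _ = condH H γ W := by
          rw [Finset.coe_image]; exact condH_image (τ := τ ^ L) (rank_image_pow hτ L) γ W
      _ ≤ _ := by rw [hH.condH_coe]; exact hW'.le
  refine ⟨K * (rate H τ Y + ε / 2) + C, fun n => ?_⟩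
  have low : n * rate H τ γ + n * condH H Y 𝒵 ≤ H (blk τ γ' n ∪ blk τ Y n) := by
    have h1 : H (blk τ γ' n ∪ blk τ Y n) =
        H (blk τ γ' n) + condH H (blk τ Y n) (blk τ γ' n) := by
      rw [hH.condH_coe, Finset.union_comm]; ring
    have h2 : H (blk τ γ' n) = H (blk τ γ n) := by
      rw [blk_image_pow, rank_image_pow hτ]
    have h3 : condH H (blk τ Y n) (orb τ (γ : Set M) ∪ fut τ Y n) ≤
        condH H (blk τ Y n) (blk τ γ' n) := by
      refine hH.condH_anti _ (Subset.trans ?_ subset_union_left)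
      intro x hx
      obtain ⟨i, -, _, hb', rfl⟩ := mem_blk.1 (Finset.mem_coe.1 hx)
      obtain ⟨b, hb, rfl⟩ := Finset.mem_image.1 hb'
      exact ⟨i + L, b, hb, by rw [zpow_add]; simp⟩
    rw [hH.condH_blk_fut hτ Y (image_orb _)] at h3
    have h4 : condH H Y 𝒵 ≤ condH H Y (orb τ (γ : Set M) ∪ fut τ Y 1) := by
      rw [← hH.condH_clH Y 𝒵]
      exact hH.condH_anti _ (union_subset hγ hY)
    have h5 := hH.mul_rate_le hτ γ n
    have h6 : (n : ℝ) * condH H Y 𝒵 ≤ n * condH H Y (orb τ (γ : Set M) ∪ fut τ Y 1) := by gcongr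
    linarith
  have up : H (blk τ γ' n ∪ blk τ Y n) ≤
      (n + K : ℕ) * (rate H τ Y + ε / 2) + C + n * (condH H γ (orb τ Y) + ε / 2) := by
    have h1 : H (blk τ γ' n ∪ blk τ Y n) ≤ H (blk τ γ' n ∪ blk τ Y (n + K)) :=
      hH.mono _ _ (Finset.union_subset_union_right (blk_mono _ (by omega)))
    have h2 := hH.condH_blk_blk_le hτ γ' Y 1 n K
    rw [one_mul, blk_one, hH.condH_coe] at h2
    have h3 : (n : ℝ) * condH H γ' (blk τ Y K) ≤ n * (condH H γ (orb τ Y) + ε / 2) := by gcongr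
    have := hC (n + K)
    linarith
  push_cast at up
  linarith

/-- The distant future of a second set does not reduce the rate of the first one. -/
lemma exists_rate_sub_le_condH (hH : IsPolymatroid H) (hτ : ∀ S : Finset M, H (S.image τ) = H S)
    (B U : Finset M) {ε : ℝ} (hε : 0 < ε) :
    ∃ p, rate H τ B - ε ≤ condH H B (fut τ B 1 ∪ fut τ U p) := by
  by_contra! hcon
  have main : rate H τ B ≤ rate H τ B - ε := by
    refine le_of_forall_mul_le_add fun ε' hε' => ?_
    obtain ⟨C, -, hC⟩ := hH.rank_blk_le hτ (B ∪ U) hε'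
    refine ⟨C, fun n => ?_⟩
    have h1 : condH H (blk τ B n) (fut τ B n ∪ fut τ U n) ≤ n * (rate H τ B - ε) := by
      induction n with
      | zero => simp [blk_zero, hH.condH_empty_left]
      | succ n ih =>
        have e : fut τ (B : Set M) (n + 1) ∪ fut τ (U : Set M) (n + 1) =
            τ '' (fut τ B n ∪ fut τ U n) := by rw [image_union, image_fut, image_fut]
        rw [e, hH.condH_blk_succ hτ, ← e, union_right_comm, fut_succ_union_blk]
        have := hcon (n + 1)
        push_cast
        linarith
    have h2 := hH.condH_blk_fut hτ (B ∪ U) (𝒰 := ∅) (by simp) n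
    simp only [empty_union] at h2
    rw [blk_union, hH.condH_union, Finset.coe_union] at h2
    have h3 : condH H (blk τ U n) (fut τ (B ∪ U : Set M) n ∪ blk τ B n) ≤
        H (blk τ (B ∪ U) n) - H (blk τ B n) := by
      refine (hH.condH_anti _ subset_union_right).trans_eq ?_
      rw [hH.condH_coe, blk_union, Finset.union_comm]
    rw [← fut_union] at h1
    have h4 := hH.mul_rate_le hτ B n
    have h5 := hC n
    have h6 : rate H τ (B ∪ U) = condH H (B ∪ U) (fut τ (B ∪ U : Set M) 1) := by
      rw [rate, Finset.coe_union]
    rw [← h6] at h2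
    linarith
  linarith

end IsPolymatroid

end PolymatroidDynamics

section PinskerClosure

open Classical

variable {M : Type*} {H : Finset M → ℝ} {τ : Equiv.Perm M}

namespace IsPolymatroid

lemma condH_sub_le_of_subset (hH : IsPolymatroid H) {S B : Finset M} (hS : S ⊆ B)
    {𝒱 𝒱' : Set M} (h : 𝒱 ⊆ 𝒱') {η : ℝ} (hB : condH H B 𝒱 - η ≤ condH H B 𝒱') :
    condH H S 𝒱 - η ≤ condH H S 𝒱' := by
  have e : S ∪ B = B := Finset.union_eq_right.2 hS
  have h1 := hH.condH_union S B 𝒱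
  have h2 := hH.condH_union S B 𝒱'
  rw [e] at h1 h2
  have h3 := hH.condH_anti B (union_subset_union_left (S : Set M) h)
  linarith

lemma zpow_mem_clH (hτ : ∀ S : Finset M, H (S.image τ) = H S)
    {a : M} {𝒲 : Set M} (ha : a ∈ clH H 𝒲) (m : ℤ) :
    (τ ^ m) a ∈ clH H ((τ ^ m : Equiv.Perm M) '' 𝒲) := by
  have := condH_image (τ := τ ^ m) (rank_image_zpow hτ m) {a} 𝒲
  rw [Finset.image_singleton] at this
  exact this.trans ha

/-- Given a generating sequence, there are shifts of its members such that every element of the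
tail closure of the shifted sequence has zero rate. -/
theorem exists_shifts (hH : IsPolymatroid H) (hτ : ∀ S : Finset M, H (S.image τ) = H S)
    (U : ℕ → M) (hU : ∀ a, condH H {a} (orb τ (range U)) = 0) :
    ∃ k : ℕ → ℕ, ∀ a, (∀ n, a ∈ clH H (fut τ (range fun i => (τ ^ k i) (U i)) n)) →
      rate H τ {a} = 0 := by
  have hη : ∀ j : ℕ, (0 : ℝ) < (1 / 2) ^ j := fun j => by positivity
  choose p hp using fun (B : Finset M) (j : ℕ) =>
    hH.exists_rate_sub_le_condH hτ B {U j} (hη j)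
  let β : ℕ → Finset M := fun j =>
    Nat.rec (motive := fun _ => Finset M) ∅ (fun j B => insert ((τ ^ p B j) (U j)) B) j
  have hβ : ∀ j, β (j + 1) = insert ((τ ^ p (β j) j) (U j)) (β j) := fun j => rfl
  let k : ℕ → ℕ := fun j => p (β j) j
  let b : ℕ → M := fun i => (τ ^ k i) (U i)
  have hβm : Monotone β := monotone_nat_of_le_succ fun j => by
    rw [hβ]; exact Finset.subset_insert _ _
  have hβr : ∀ j, (β j : Set M) ⊆ range b := by
    intro j
    induction j with
    | zero => simp [β]
    | succ j ih =>
      rw [hβ, Finset.coe_insert, insert_subset_iff]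
      exact ⟨⟨j, rfl⟩, ih⟩
  have hbβ : ∀ j, b j ∈ β (j + 1) := fun j => by rw [hβ]; exact Finset.mem_insert_self _ _
  have hfm : ∀ j, fut τ (β j : Set M) 1 ⊆ fut τ (β (j + 1) : Set M) 1 := fun j =>
    fut_mono (by exact_mod_cast hβm (Nat.le_succ j)) 1
  have hstep : ∀ j, condH H (β j) (fut τ (β j) 1) - (1 / 2) ^ j ≤
      condH H (β j) (fut τ (β (j + 1)) 1) := by
    intro j
    refine (hp (β j) j).trans (hH.condH_anti _ ?_)
    rw [hβ, Finset.coe_insert, insert_eq, union_comm, fut_union]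
    refine union_subset_union_right _ ?_
    rintro _ ⟨m, hm, _, rfl, rfl⟩
    refine ⟨m + p (β j) j, by omega, U j, by simp, by rw [pow_add]; rfl⟩
  have hsum : ∀ l J, l ≤ J → rate H τ (β l) - (2 * (1 / 2) ^ l - 2 * (1 / 2) ^ J) ≤
      condH H (β l) (fut τ (β J) 1) := by
    intro l J hJ
    induction J, hJ using Nat.le_induction with
    | base => simp [rate]
    | succ J hJ ih =>
      have := hH.condH_sub_le_of_subset (hβm hJ) (hfm J) (hstep J)
      rw [pow_succ]
      linarith
  have hUfut : fut τ (range b) 1 = ⋃ J, fut τ (β J : Set M) 1 := by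
    ext x
    simp only [mem_iUnion, mem_fut]
    constructor
    · rintro ⟨m, hm, _, ⟨i, rfl⟩, rfl⟩
      exact ⟨i + 1, m, hm, b i, hbβ i, rfl⟩
    · rintro ⟨J, m, hm, y, hy, rfl⟩
      exact ⟨m, hm, y, hβr J hy, rfl⟩
  have hlim : ∀ l, rate H τ (β l) - 2 * (1 / 2) ^ l ≤ condH H (β l) (fut τ (range b) 1) := by
    intro l
    refine le_of_forall_pos_le_add fun ε hε => ?_
    have hmono : Monotone fun J => fut τ (β J : Set M) 1 := monotone_nat_of_le_succ hfm
    obtain ⟨J, hJ⟩ := hH.exists_condH_le_of_monotone (β l) hmono hε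
    rw [← hUfut] at hJ
    have h1 := hsum l (max l J) (le_max_left _ _)
    have h2 := hH.condH_anti (β l) (hmono (le_max_right l J))
    have h3 := hη (max l J)
    simp only at h2
    linarith
  have horb : orb τ (range U) = ⋃ J, orb τ (β J : Set M) := by
    ext x
    simp only [mem_iUnion]
    constructor
    · rintro ⟨m, _, ⟨i, rfl⟩, rfl⟩
      refine ⟨i + 1, m - k i, b i, hbβ i, ?_⟩
      simp only [b]
      rw [← Equiv.Perm.mul_apply, ← zpow_natCast, ← zpow_add, sub_add_cancel]
    · rintro ⟨J, m, y, hy, rfl⟩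
      obtain ⟨i, rfl⟩ := hβr J hy
      refine ⟨m + k i, U i, ⟨i, rfl⟩, ?_⟩
      simp only [b]
      rw [← Equiv.Perm.mul_apply, ← zpow_natCast, ← zpow_add]
  refine ⟨k, fun a ha => ?_⟩
  refine le_antisymm (le_of_forall_pos_le_add fun ε hε => ?_) (hH.rate_nonneg _)
  obtain ⟨l₁, hl₁⟩ := hH.exists_condH_le_of_monotone {a} (𝒱 := fun J => orb τ (β J : Set M))
    (fun i j h => orb_mono (by exact_mod_cast hβm h)) (half_pos hε)
  rw [← horb, hU, zero_add] at hl₁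
  obtain ⟨l₂, hl₂⟩ := exists_pow_lt_of_lt_one (show 0 < ε / 4 by positivity)
    (show (1 / 2 : ℝ) < 1 by norm_num)
  set l := max l₁ l₂
  have h1 : condH H {a} (orb τ (β l : Set M)) ≤ ε / 2 :=
    (hH.condH_anti _ (orb_mono (by exact_mod_cast hβm (le_max_left l₁ l₂)))).trans hl₁.le
  have h2 : (1 / 2 : ℝ) ^ l ≤ ε / 4 :=
    (pow_le_pow_of_le_one (by norm_num) (by norm_num) (le_max_right l₁ l₂)).trans hl₂.le
  have h3 := hH.rate_add_condH_le hτ (γ := {a}) (Y := β l) (𝒵 := fut τ (range b) 1) ?_ ?_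
  · have := hlim l
    linarith
  · rintro _ ⟨m, x, hx, rfl⟩
    obtain rfl : x = a := by simpa using hx
    exact hH.clH_mono (image_zpow_fut_subset _ m (n := (1 - m).toNat) (by omega))
      (zpow_mem_clH hτ (ha _) m)
  · exact (fut_mono (hβr l) 1).trans (hH.subset_clH _)

lemma rank_blk_le_of_rate_eq_zero (hH : IsPolymatroid H)
    (hτ : ∀ S : Finset M, H (S.image τ) = H S) (W : Finset M)
    (hW : ∀ a ∈ W, rate H τ {a} = 0) {ε : ℝ} (hε : 0 < ε) :
    ∃ C, ∀ n : ℕ, H (blk τ W n) ≤ n * ε + C := by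
  induction W using Finset.induction_on generalizing ε with
  | empty => exact ⟨0, fun n => by
      have : blk τ (∅ : Finset M) n = ∅ := by ext; simp [mem_blk]
      rw [this, hH.empty]; positivity⟩
  | insert a W ha ih =>
    obtain ⟨C₁, h₁⟩ := ih (fun b hb => hW b (Finset.mem_insert_of_mem hb)) (half_pos hε)
    obtain ⟨C₂, -, h₂⟩ := hH.rank_blk_le hτ {a} (half_pos hε)
    rw [hW a (Finset.mem_insert_self _ _)] at h₂
    refine ⟨C₁ + C₂, fun n => ?_⟩
    rw [Finset.insert_eq, blk_union]
    have := hH.union_le (blk τ {a} n) (blk τ W n)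
    have := h₁ n
    have := h₂ n
    linarith

/-- Conditioning on elements of zero rate does not lower the growth of the rank of blocks. -/
theorem mul_rate_le_condH (hH : IsPolymatroid H)
    (hτ : ∀ S : Finset M, H (S.image τ) = H S) (S : Finset M) (m : ℕ) :
    m * rate H τ S ≤ condH H (blk τ S m) {a | rate H τ {a} = 0} := by
  refine le_condH fun W hW => ?_
  refine le_of_forall_mul_le_add fun ε hε => ?_
  obtain ⟨C, hC⟩ := hH.rank_blk_le_of_rate_eq_zero hτ W (fun a ha => hW ha)
    (show 0 < ε / (m + 1) by positivity)
  refine ⟨C + H (blk τ W 1), fun n => ?_⟩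
  have h1 := hH.condH_blk_blk_le hτ S W m n 1
  rw [blk_one, hH.condH_coe, hH.condH_coe] at h1
  have h2 := hH.mul_rate_le hτ S (m * n)
  have h3 := hH.mono _ _ (Finset.subset_union_left (s₁ := blk τ S (m * n))
    (s₂ := blk τ W (m * n + 1)))
  have h4 : H (blk τ W (m * n + 1)) ≤ H (blk τ W (m * n)) + H (blk τ W 1) := by
    rw [blk_add]
    refine (hH.union_le _ _).trans_eq ?_
    rw [rank_image_pow hτ]
  have h5 := hC (m * n)
  have h6 : ((m * n : ℕ) : ℝ) * (ε / (m + 1)) ≤ n * ε := by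
    have : (m : ℝ) / (m + 1) ≤ 1 := by rw [div_le_one (by positivity)]; linarith
    calc ((m * n : ℕ) : ℝ) * (ε / (m + 1)) = (m / (m + 1)) * (n * ε) := by push_cast; ring
      _ ≤ 1 * (n * ε) := by gcongr
      _ = _ := one_mul _
  push_cast at h2
  linarith

end IsPolymatroid

end PinskerClosure

section Entropy

open Classical Real

/-- The entropy gain of splitting a cell of mass `p + q` into cells of masses `p` and `q`. -/
def splitGain (p q : ℝ) : ℝ := negMulLog p + negMulLog q - negMulLog (p + q)

lemma splitGain_zero_left (q : ℝ) : splitGain 0 q = 0 := by simp [splitGain]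

lemma splitGain_zero_right (p : ℝ) : splitGain p 0 = 0 := by simp [splitGain]

lemma splitGain_mul (c p q : ℝ) : splitGain (c * p) (c * q) = c * splitGain p q := by
  simp only [splitGain, ← mul_add, negMulLog_mul]
  ring

lemma mul_div_sub_le_mul_log {p r c N : ℝ} (hp : 0 ≤ p) (hr : p ≤ r) (hc : p ≤ c) (hN : 0 < N) :
    p - r * c / N ≤ p * log p + p * log N - p * log r - p * log c := by
  rcases hp.eq_or_lt with rfl | hp
  · have : 0 ≤ r * c / N := by positivity
    simpa using this
  · have hr' := hp.trans_le hr
    have hc' := hp.trans_le hc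
    have h := Real.log_le_sub_one_of_pos (show 0 < r * c / (N * p) by positivity)
    rw [log_div (by positivity) (by positivity), log_mul (by positivity) (by positivity),
      log_mul (by positivity) (by positivity)] at h
    have h2 := mul_le_mul_of_nonneg_left h hp.le
    have h3 : p * (r * c / (N * p) - 1) = r * c / N - p := by field_simp
    linarith

lemma splitGain_add_le {p q p' q' : ℝ} (hp : 0 ≤ p) (hq : 0 ≤ q) (hp' : 0 ≤ p') (hq' : 0 ≤ q') :
    splitGain p q + splitGain p' q' ≤ splitGain (p + p') (q + q') := by
  have hN : 0 ≤ p + q + (p' + q') := by positivity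
  rcases hN.eq_or_lt with h | hN
  · obtain rfl : p = 0 := by linarith
    obtain rfl : q = 0 := by linarith
    obtain rfl : p' = 0 := by linarith
    obtain rfl : q' = 0 := by linarith
    simp [splitGain]
  · have h1 := mul_div_sub_le_mul_log (r := p + q) (c := p + p') hp (by linarith) (by linarith) hN
    have h2 := mul_div_sub_le_mul_log (r := p + q) (c := q + q') hq (by linarith) (by linarith) hN
    have h3 := mul_div_sub_le_mul_log (r := p' + q') (c := p + p') hp' (by linarith)
      (by linarith) hN
    have h4 := mul_div_sub_le_mul_log (r := p' + q') (c := q + q') hq' (by linarith)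
      (by linarith) hN
    have h5 : p - (p + q) * (p + p') / (p + q + (p' + q')) +
        (q - (p + q) * (q + q') / (p + q + (p' + q'))) +
        (p' - (p' + q') * (p + p') / (p + q + (p' + q'))) +
        (q' - (p' + q') * (q + q') / (p + q + (p' + q'))) = 0 := by
      field_simp
      ring
    have e : p + p' + (q + q') = p + q + (p' + q') := by ring
    simp only [splitGain, negMulLog, e]
    nlinarith

lemma splitGain_nonneg {p q : ℝ} (hp : 0 ≤ p) (hq : 0 ≤ q) : 0 ≤ splitGain p q := by
  have := splitGain_add_le hp le_rfl le_rfl hq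
  simpa [splitGain_zero_left, splitGain_zero_right] using this

lemma sum_splitGain_le {ι : Type*} (s : Finset ι) (p q : ι → ℝ) (hp : ∀ i, 0 ≤ p i)
    (hq : ∀ i, 0 ≤ q i) :
    ∑ i ∈ s, splitGain (p i) (q i) ≤ splitGain (∑ i ∈ s, p i) (∑ i ∈ s, q i) := by
  induction s using Finset.induction_on with
  | empty => simp [splitGain]
  | insert a s ha ih =>
    rw [Finset.sum_insert ha, Finset.sum_insert ha, Finset.sum_insert ha]
    refine le_trans ?_ (splitGain_add_le (hp a) (hq a) (Finset.sum_nonneg fun i _ => hp i)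
      (Finset.sum_nonneg fun i _ => hq i))
    gcongr

/-- The measurable subsets of `X`. -/
@[ext]
structure MSet (X : Type*) [MeasurableSpace X] where
  val : Set X
  property : MeasurableSet val

/-- The points of `X` which belong to exactly those members of `S` which lie in `R`. -/
def cell [MeasurableSpace X] (S R : Finset (MSet X)) : Set X :=
  {x | ∀ A ∈ S, x ∈ A.1 ↔ A ∈ R}

/-- The Shannon entropy of the partition generated by the finite family `S`. -/
def ent [MeasurableSpace X] (μ : Measure X) (S : Finset (MSet X)) : ℝ :=
  ∑ R ∈ S.powerset, negMulLog (μ.real (cell S R))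

/-- The entropy gained by adding `a` to the family `S`. -/
def entGain [MeasurableSpace X] (μ : Measure X) (a : MSet X) (S : Finset (MSet X)) : ℝ :=
  ∑ R ∈ S.powerset, splitGain (μ.real (cell S R ∩ a.1)) (μ.real (cell S R \ a.1))

variable [MeasurableSpace X]

lemma measurableSet_cell (S R : Finset (MSet X)) : MeasurableSet (cell S R) := by
  have : cell S R = ⋂ A ∈ S, {x | x ∈ A.1 ↔ A ∈ R} := by ext; simp [cell]
  rw [this]
  refine Finset.measurableSet_biInter _ fun A _ => ?_
  by_cases h : A ∈ R
  · have : {x | x ∈ A.1 ↔ A ∈ R} = A.1 := by ext; simp [h]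
    rw [this]; exact A.2
  · have : {x | x ∈ A.1 ↔ A ∈ R} = A.1ᶜ := by ext; simp [h]
    rw [this]; exact A.2.compl

lemma cell_insert {a : MSet X} {S R : Finset (MSet X)} (ha : a ∉ S) (hR : R ⊆ S) :
    cell (insert a S) R = cell S R \ a.1 := by
  ext x
  have : a ∉ R := fun h => ha (hR h)
  simp [cell, this, and_comm]

lemma cell_insert_insert {a : MSet X} {S R : Finset (MSet X)} (ha : a ∉ S) :
    cell (insert a S) (insert a R) = cell S R ∩ a.1 := by
  ext x
  simp only [cell, Finset.mem_insert, mem_ofPred_eq, mem_inter_iff]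
  constructor
  · intro h
    refine ⟨fun A hA => ?_, (h a (Or.inl rfl)).2 (Or.inl rfl)⟩
    have hne : A ≠ a := fun e => ha (e ▸ hA)
    simpa [hne] using h A (Or.inr hA)
  · rintro ⟨h, hx⟩ A (rfl | hA)
    · simp [hx]
    · have hne : A ≠ a := fun e => ha (e ▸ hA)
      simpa [hne] using h A hA

lemma mem_cell_filter (S : Finset (MSet X)) (x : X) :
    x ∈ cell S (S.filter fun A => x ∈ A.1) := by
  intro A hA
  simp [hA]

lemma cell_filter_eq {S R : Finset (MSet X)} (hR : R ⊆ S) {x : X} (hx : x ∈ cell S R) :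
    S.filter (fun A => x ∈ A.1) = R := by
  ext A
  simp only [Finset.mem_filter]
  exact ⟨fun h => (hx A h.1).1 h.2, fun h => ⟨hR h, (hx A (hR h)).2 h⟩⟩

lemma cell_disjoint {S R R' : Finset (MSet X)} (hR : R ⊆ S) (hR' : R' ⊆ S) (h : R ≠ R') :
    Disjoint (cell S R) (cell S R') :=
  Set.disjoint_left.2 fun _ hx hx' => h ((cell_filter_eq hR hx).symm.trans (cell_filter_eq hR' hx'))

variable (μ : Measure X)

lemma ent_insert [IsFiniteMeasure μ] (a : MSet X) (S : Finset (MSet X)) :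
    ent μ (insert a S) = ent μ S + entGain μ a S := by
  by_cases ha : a ∈ S
  · rw [Finset.insert_eq_of_mem ha, entGain, Finset.sum_eq_zero, add_zero]
    intro R hR
    by_cases haR : a ∈ R
    · have : cell S R \ a.1 = ∅ := by
        ext x
        simp only [Set.mem_sdiff, mem_empty_iff_false, iff_false, not_and, not_not]
        exact fun hx => (hx a ha).2 haR
      rw [this]; simp [splitGain_zero_right]
    · have : cell S R ∩ a.1 = ∅ := by
        ext x
        simp only [mem_inter_iff, mem_empty_iff_false, iff_false, not_and]
        exact fun hx h => haR ((hx a ha).1 h)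
      rw [this]; simp [splitGain_zero_left]
  · rw [ent, Finset.sum_powerset_insert ha, ent, entGain, ← Finset.sum_add_distrib,
      ← Finset.sum_add_distrib]
    refine Finset.sum_congr rfl fun R hR => ?_
    rw [cell_insert ha (Finset.mem_powerset.1 hR), cell_insert_insert ha, splitGain,
      measureReal_inter_add_sdiff a.2]
    ring

lemma entGain_nonneg (a : MSet X) (S : Finset (MSet X)) : 0 ≤ entGain μ a S :=
  Finset.sum_nonneg fun _ _ => splitGain_nonneg measureReal_nonneg measureReal_nonneg

lemma entGain_insert_le [IsFiniteMeasure μ] (a b : MSet X) (S : Finset (MSet X)) :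
    entGain μ a (insert b S) ≤ entGain μ a S := by
  by_cases hb : b ∈ S
  · rw [Finset.insert_eq_of_mem hb]
  · rw [entGain, Finset.sum_powerset_insert hb, ← Finset.sum_add_distrib, entGain]
    refine Finset.sum_le_sum fun R hR => ?_
    rw [cell_insert hb (Finset.mem_powerset.1 hR), cell_insert_insert hb]
    refine (splitGain_add_le measureReal_nonneg measureReal_nonneg measureReal_nonneg
      measureReal_nonneg).trans_eq ?_
    congr 1
    · rw [← measureReal_inter_add_sdiff (s := cell S R ∩ a.1) b.2, add_comm]
      congr 2 <;> (ext; simp; tauto)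
    · rw [← measureReal_inter_add_sdiff (s := cell S R \ a.1) b.2, add_comm]
      congr 2 <;> (ext; simp; tauto)

lemma entGain_anti [IsFiniteMeasure μ] (a : MSet X) {S S' : Finset (MSet X)} (h : S ⊆ S') :
    entGain μ a S' ≤ entGain μ a S := by
  rw [← Finset.union_eq_right.2 h, Finset.union_comm]
  clear h
  induction S' using Finset.induction_on with
  | empty => simp
  | insert b T hb ih =>
    rw [Finset.insert_union]
    exact (entGain_insert_le μ a b _).trans ih

/-- The Shannon entropy of a probability measure is a polymatroid. -/
theorem isPolymatroid_ent [IsProbabilityMeasure μ] : IsPolymatroid (ent μ) where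
  empty := by simp [ent, cell]
  mono S S' h := by
    rw [← Finset.union_eq_right.2 h, Finset.union_comm]
    clear h
    induction S' using Finset.induction_on with
    | empty => simp
    | insert b T hb ih =>
      rw [Finset.insert_union, ent_insert]
      linarith [entGain_nonneg μ b (T ∪ S)]
  submod S W W' h := by
    induction S using Finset.induction_on with
    | empty => simp [add_comm]
    | insert a S ha ih =>
      rw [Finset.insert_union, Finset.insert_union, ent_insert, ent_insert]
      linarith [entGain_anti μ a (Finset.union_subset_union_right (s := S) h)]

/-- Conditional entropy is concave in the measure. -/
lemma sum_ent_sub_le_of_average {n : ℕ} (ν : ℕ → Measure X) [∀ i, IsFiniteMeasure (ν i)]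
    [IsFiniteMeasure μ]
    (h : ∀ A, MeasurableSet A → n * μ.real A = ∑ i ∈ Finset.range n, (ν i).real A)
    (S W : Finset (MSet X)) :
    ∑ i ∈ Finset.range n, (ent (ν i) (S ∪ W) - ent (ν i) W) ≤ n * (ent μ (S ∪ W) - ent μ W) := by
  induction S using Finset.induction_on with
  | empty => simp
  | insert a S ha ih =>
    have key : ∑ i ∈ Finset.range n, entGain (ν i) a (S ∪ W) ≤ n * entGain μ a (S ∪ W) := by
      unfold entGain
      rw [Finset.sum_comm, Finset.mul_sum]
      refine Finset.sum_le_sum fun R _ => ?_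
      rw [← splitGain_mul, h _ ((measurableSet_cell _ _).inter a.2),
        h _ ((measurableSet_cell _ _).diff a.2)]
      exact sum_splitGain_le _ _ _ (fun _ => measureReal_nonneg) (fun _ => measureReal_nonneg)
    simp only [Finset.insert_union, ent_insert]
    calc _ = ∑ i ∈ Finset.range n, (ent (ν i) (S ∪ W) - ent (ν i) W) +
          ∑ i ∈ Finset.range n, entGain (ν i) a (S ∪ W) := by
            rw [← Finset.sum_add_distrib]
            exact Finset.sum_congr rfl fun _ _ => by ring
      _ ≤ _ := by linarith

lemma ent_insert_eq_of_null [IsFiniteMeasure μ] {a : MSet X} {S : Finset (MSet X)}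
    (h : ∀ R ⊆ S, μ (cell S R ∩ a.1) = 0 ∨ μ (cell S R \ a.1) = 0) :
    ent μ (insert a S) = ent μ S := by
  rw [ent_insert, entGain, Finset.sum_eq_zero, add_zero]
  intro R hR
  rcases h R (Finset.mem_powerset.1 hR) with h | h
  · rw [measureReal_def, h]; simp [splitGain_zero_left]
  · rw [measureReal_def (s := _ \ _), h]; simp [splitGain_zero_right]

lemma ent_insert_eq_of_mem_iff [IsFiniteMeasure μ] {a : MSet X} {S : Finset (MSet X)}
    (h : ∀ x y, (∀ A ∈ S, x ∈ A.1 ↔ y ∈ A.1) → (x ∈ a.1 ↔ y ∈ a.1)) :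
    ent μ (insert a S) = ent μ S := by
  refine ent_insert_eq_of_null μ fun R _ => ?_
  by_cases hne : (cell S R ∩ a.1).Nonempty
  · obtain ⟨x, hx, hxa⟩ := hne
    right
    convert measure_empty (μ := μ)
    ext y
    simp only [Set.mem_sdiff, mem_empty_iff_false, iff_false, not_and, not_not]
    intro hy
    exact (h x y fun A hA => (hx A hA).trans (hy A hA).symm).1 hxa
  · left
    rw [not_nonempty_iff_eq_empty.1 hne, measure_empty]

lemma ent_singleton [IsFiniteMeasure μ] (a : MSet X) :
    ent μ {a} = negMulLog (μ.real a.1) + negMulLog (μ.real a.1ᶜ) := by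
  have h0 : ent μ ∅ = negMulLog (μ.real univ) := by simp [ent, cell]
  rw [← insert_empty_eq, ent_insert, h0, entGain]
  have : cell (∅ : Finset (MSet X)) ∅ = univ := by ext; simp [cell]
  simp [this, splitGain, ← compl_eq_univ_sdiff, measureReal_add_measureReal_compl a.2]

lemma ent_singleton_le [IsProbabilityMeasure μ] (a : MSet X) : ent μ {a} ≤ log 2 := by
  rw [ent_singleton, probReal_compl_eq_one_sub a.2, ← binEntropy_eq_negMulLog_add_negMulLog_one_sub]
  exact binEntropy_le_log_two

lemma ent_le_card [IsProbabilityMeasure μ] (S : Finset (MSet X)) : ent μ S ≤ S.card * log 2 := by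
  refine ((isPolymatroid_ent μ).le_sum_singleton S).trans ?_
  refine (Finset.sum_le_card_nsmul S _ _ fun a _ => ent_singleton_le μ a).trans_eq ?_
  simp

lemma ent_singleton_small [IsProbabilityMeasure μ] {ε : ℝ} (hε : 0 < ε) :
    ∃ δ > 0, ∀ a : MSet X, μ.real a.1 < δ → ent μ {a} < ε := by
  have hc : ContinuousAt binEntropy 0 := binEntropy_continuous.continuousAt
  rw [Metric.continuousAt_iff] at hc
  obtain ⟨δ, hδ, h⟩ := hc ε hε
  refine ⟨δ, hδ, fun a ha => ?_⟩
  rw [ent_singleton, probReal_compl_eq_one_sub a.2, ← binEntropy_eq_negMulLog_add_negMulLog_one_sub]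
  have := h (x := μ.real a.1) (by rwa [dist_zero_right, Real.norm_of_nonneg measureReal_nonneg])
  rw [binEntropy_zero, dist_zero_right, Real.norm_eq_abs] at this
  exact (le_abs_self _).trans_lt this

lemma mem_clH_of_mem_iff [IsProbabilityMeasure μ] {𝒵 : Set (MSet X)} {a : MSet X}
    {W : Finset (MSet X)} (hW : (W : Set (MSet X)) ⊆ clH (ent μ) 𝒵)
    (h : ∀ x y, (∀ A ∈ W, x ∈ A.1 ↔ y ∈ A.1) → (x ∈ a.1 ↔ y ∈ a.1)) : a ∈ clH (ent μ) 𝒵 := by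
  have hH := isPolymatroid_ent μ
  rw [← hH.clH_clH]
  refine hH.clH_mono hW ?_
  change condH _ _ _ = 0
  rw [hH.condH_coe, ← Finset.insert_eq, ent_insert_eq_of_mem_iff μ h, sub_self]

lemma compl_mem_clH [IsProbabilityMeasure μ] {𝒵 : Set (MSet X)} {A : Set X}
    (hA : MeasurableSet A) (h : (⟨A, hA⟩ : MSet X) ∈ clH (ent μ) 𝒵) :
    (⟨Aᶜ, hA.compl⟩ : MSet X) ∈ clH (ent μ) 𝒵 := by
  refine mem_clH_of_mem_iff μ (W := {⟨A, hA⟩}) (by simpa using h) fun x y h => ?_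
  exact not_congr (h ⟨A, hA⟩ (by simp))

lemma ent_insert_le_symmDiff [IsProbabilityMeasure μ] (a b d : MSet X)
    (h : ∀ x, x ∉ d.1 → (x ∈ a.1 ↔ x ∈ b.1))
    (h' : ∀ x ∈ d.1, x ∈ a.1 ∧ x ∉ b.1 ∨ x ∉ a.1 ∧ x ∈ b.1) :
    ent μ ({a} ∪ {b}) ≤ ent μ {d} + ent μ {b} := by
  have hH := isPolymatroid_ent μ
  refine le_trans ?_ (hH.union_le {d} {b})
  refine (hH.mono _ (insert a ({d} ∪ {b})) (by intro x; simp; tauto)).trans_eq ?_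
  apply ent_insert_eq_of_mem_iff
  intro x y hxy
  have h1 := hxy d (by simp)
  have h2 := hxy b (by simp)
  have := h x; have := h y; have := h' x; have := h' y
  tauto

lemma mem_clH_iUnion [IsProbabilityMeasure μ] {𝒵 : Set (MSet X)} (a : ℕ → MSet X)
    (ha : ∀ i, a i ∈ clH (ent μ) 𝒵) :
    (⟨⋃ i, (a i).1, .iUnion fun i => (a i).2⟩ : MSet X) ∈ clH (ent μ) 𝒵 := by
  have hH := isPolymatroid_ent μ
  set u : MSet X := ⟨⋃ i, (a i).1, .iUnion fun i => (a i).2⟩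
  refine le_antisymm (le_of_forall_pos_le_add fun ε hε => ?_) (hH.condH_nonneg _ _)
  obtain ⟨δ, hδ, hsmall⟩ := ent_singleton_small μ hε
  let b : ℕ → MSet X := fun n => ⟨⋃ i ≤ n, (a i).1, .iUnion fun i => .iUnion fun _ => (a i).2⟩
  let d : ℕ → MSet X := fun n => ⟨u.1 \ (b n).1, u.2.diff (b n).2⟩
  have hb : ∀ n, b n ∈ clH (ent μ) 𝒵 := by
    intro n
    refine mem_clH_of_mem_iff μ (W := (Finset.range (n + 1)).image a) ?_ fun x y h => ?_
    · intro x hx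
      obtain ⟨i, -, rfl⟩ := Finset.mem_image.1 (Finset.mem_coe.1 hx)
      exact ha i
    simp only [b, mem_iUnion]
    refine exists_congr fun i => exists_congr fun hi => h _ ?_
    exact Finset.mem_image_of_mem _ (by simpa [Nat.lt_succ_iff] using hi)
  have hlim : Tendsto (fun n => μ (d n).1) atTop (𝓝 0) := by
    have := tendsto_measure_iInter_atTop (μ := μ) (s := fun n => (d n).1)
      (fun n => (d n).2.nullMeasurableSet) ?_ ⟨0, measure_ne_top _ _⟩
    · have h0 : ⋂ n, (d n).1 = ∅ := by
        ext x
        simp only [d, b, u, mem_iInter, Set.mem_sdiff, mem_iUnion, mem_empty_iff_false, iff_false]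
        intro h
        obtain ⟨i, hi⟩ := (h 0).1
        exact (h i).2 ⟨i, le_rfl, hi⟩
      rwa [h0, measure_empty] at this
    · intro m n hmn
      refine sdiff_le_sdiff_left ?_
      intro x
      simp only [b, mem_iUnion]
      rintro ⟨i, hi, hx⟩
      exact ⟨i, hi.trans hmn, hx⟩
  have hlim' : Tendsto (fun n => μ.real (d n).1) atTop (𝓝 0) :=
    (ENNReal.tendsto_toReal ENNReal.zero_ne_top).comp hlim
  obtain ⟨n, hn⟩ := (hlim'.eventually (gt_mem_nhds hδ)).exists
  have h1 := hsmall _ hn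
  have h2 := ent_insert_le_symmDiff μ u (b n) (d n) (fun x hx => by
    simp only [d, Set.mem_sdiff, not_and, not_not] at hx
    refine ⟨hx, fun h => ?_⟩
    simp only [b, mem_iUnion] at h
    obtain ⟨i, -, h⟩ := h
    exact mem_iUnion.2 ⟨i, h⟩) (fun x hx => Or.inl hx)
  have h3 : condH (ent μ) {u} 𝒵 ≤ condH (ent μ) {u} ({b n} : Finset (MSet X)) := by
    rw [← hH.condH_clH {u} 𝒵]
    exact hH.condH_anti _ (by simpa using hb n)
  rw [hH.condH_coe] at h3
  linarith

/-- The σ-algebra of measurable sets of zero conditional entropy given `𝒵`. -/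
@[reducible] def clSigma [IsProbabilityMeasure μ] (𝒵 : Set (MSet X)) : MeasurableSpace X where
  MeasurableSet' A := ∃ hA : MeasurableSet A, (⟨A, hA⟩ : MSet X) ∈ clH (ent μ) 𝒵
  measurableSet_empty := by
    exact ⟨.empty, mem_clH_of_mem_iff μ (W := ∅) (by simp) fun _ _ _ => Iff.rfl⟩
  measurableSet_compl A := fun ⟨hA, h⟩ => ⟨hA.compl, compl_mem_clH μ hA h⟩
  measurableSet_iUnion A h := by
    choose hA h using h
    exact ⟨.iUnion hA, mem_clH_iUnion μ (fun i => ⟨A i, hA i⟩) h⟩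

lemma clSigma_le [IsProbabilityMeasure μ] (𝒵 : Set (MSet X)) :
    clSigma μ 𝒵 ≤ ‹MeasurableSpace X› := fun _ h => h.1

lemma generateFrom_le_clSigma [IsProbabilityMeasure μ] (𝒵 : Set (MSet X)) :
    MeasurableSpace.generateFrom (MSet.val '' 𝒵) ≤ clSigma μ 𝒵 := by
  refine MeasurableSpace.generateFrom_le ?_
  rintro _ ⟨A, hA, rfl⟩
  exact ⟨A.2, (isPolymatroid_ent μ).subset_clH _ hA⟩

/-- The permutation of measurable sets given by preimages. -/
def prePerm (T : X ≃ᵐ X) : Equiv.Perm (MSet X) where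
  toFun A := ⟨T ⁻¹' A.1, T.measurable A.2⟩
  invFun A := ⟨T.symm ⁻¹' A.1, T.symm.measurable A.2⟩
  left_inv A := MSet.ext (by simp [← preimage_comp])
  right_inv A := MSet.ext (by simp [← preimage_comp])

lemma prePerm_pow_apply (T : X ≃ᵐ X) (n : ℕ) (A : MSet X) :
    ((prePerm T ^ n) A).1 = T^[n] ⁻¹' A.1 := by
  induction n generalizing A with
  | zero => simp
  | succ n ih =>
    rw [pow_succ, Equiv.Perm.mul_apply, ih, Function.iterate_succ', preimage_comp]
    rfl

lemma ent_image_prePerm (T : X ≃ᵐ X) (S : Finset (MSet X)) :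
    ent μ (S.image (prePerm T)) = ent (μ.map T) S := by
  unfold ent
  symm
  refine Finset.sum_nbij' (fun R => R.image (prePerm T)) (fun R => R.image (prePerm T).symm)
    ?_ ?_ ?_ ?_ ?_
  · intro R hR
    exact Finset.mem_powerset.2 (Finset.image_subset_image (Finset.mem_powerset.1 hR))
  · intro R hR
    rw [Finset.mem_powerset] at hR ⊢
    have := Finset.image_subset_image (f := (prePerm T).symm) hR
    rwa [Finset.image_image, Equiv.symm_comp_self, Finset.image_id] at this
  · intro R _
    rw [Finset.image_image, Equiv.symm_comp_self, Finset.image_id]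
  · intro R _
    rw [Finset.image_image, Equiv.self_comp_symm, Finset.image_id]
  · intro R _
    rw [map_measureReal_apply T.measurable (measurableSet_cell _ _)]
    congr 2
    ext x
    simp only [cell, mem_preimage, mem_ofPred_eq, Finset.forall_mem_image]
    refine forall₂_congr fun A _ => ?_
    rw [(prePerm T).injective.mem_finset_image]
    rfl

end Entropy

section Separated

/-- The finite set `E` is `(n, δ)`-separated. -/
def IsSep [MetricSpace X] (T : X → X) (n : ℕ) (δ : ℝ) (E : Finset X) : Prop :=
  ∀ x ∈ E, ∀ y ∈ E, x ≠ y → ∃ i < n, δ < dist (T^[i] x) (T^[i] y)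

variable [MetricSpace X] {T : X → X} {n : ℕ} {δ : ℝ} {K : Set X}

lemma exists_card_le_of_isSep [CompactSpace X] (T : X → X) (hδ : 0 < δ) :
    ∃ C : ℕ, 0 < C ∧ ∀ n E, IsSep T n δ E → E.card ≤ C ^ n := by
  obtain ⟨t, -, ht⟩ := isCompact_univ.elim_finite_subcover_image (b := (univ : Set X))
    (c := fun x => Metric.ball x (δ / 2)) (fun _ _ => Metric.isOpen_ball)
    (fun x _ => mem_iUnion₂.2 ⟨x, mem_univ x, Metric.mem_ball_self (half_pos hδ)⟩)
  obtain ⟨ht, hcov⟩ := ht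
  have : ∀ x : X, ∃ c : t, dist x c < δ / 2 := fun x => by
    obtain ⟨c, hc, hx⟩ := mem_iUnion₂.1 (hcov (mem_univ x))
    exact ⟨⟨c, hc⟩, hx⟩
  choose c hc using this
  have := ht.fintype
  refine ⟨Fintype.card t + 1, Nat.succ_pos _, fun n E hE => ?_⟩
  refine le_trans ?_ (Nat.pow_le_pow_left (Nat.le_succ (Fintype.card t)) n)
  rw [← Fintype.card_coe E, ← (by simp : Fintype.card (Fin n → t) = Fintype.card t ^ n)]
  refine Fintype.card_le_of_injective (fun (x : E) (i : Fin n) => c (T^[i] x)) fun x y hxy => ?_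
  by_contra hne
  obtain ⟨i, hi, h⟩ := hE x x.2 y y.2 fun h => hne (Subtype.ext h)
  have h1 := hc (T^[i] x)
  have h2 := hc (T^[i] y)
  rw [← show c (T^[i] x) = c (T^[i] y) from congrFun hxy ⟨i, hi⟩] at h2
  have := dist_triangle_right (T^[i] (x : X)) (T^[i] y) (c (T^[i] x))
  linarith

lemma abs_birk_le [CompactSpace X] (T : X → X) (f : C(X, ℝ)) (n : ℕ) (x : X) :
    |birk T f n x| ≤ n * ‖f‖ := by
  refine (Finset.abs_sum_le_sum_abs _ _).trans ?_
  refine (Finset.sum_le_card_nsmul _ _ _ fun j _ => f.norm_coe_le_norm _).trans_eq ?_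
  simp

lemma exists_forall_isSep_sum_le [CompactSpace X] (T : X → X) (f : C(X, ℝ)) (hδ : 0 < δ) :
    ∃ C : ℝ, 0 ≤ C ∧
      ∀ n E, IsSep T n δ E → ∑ x ∈ E, Real.exp (birk T f n x) ≤ Real.exp (n * C) := by
  obtain ⟨C, hC, h⟩ := exists_card_le_of_isSep T hδ
  refine ⟨Real.log C + ‖f‖, add_nonneg (Real.log_natCast_nonneg C) (norm_nonneg _),
    fun n E hE => ?_⟩
  refine (Finset.sum_le_card_nsmul _ _ (Real.exp (n * ‖f‖)) fun x _ =>
    Real.exp_le_exp.2 ((le_abs_self _).trans (abs_birk_le T f n x))).trans ?_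
  rw [mul_add, Real.exp_add, nsmul_eq_mul, mul_comm (n : ℝ) (Real.log C), Real.exp_mul (Real.log C),
    Real.exp_log (by positivity), Real.rpow_natCast]
  gcongr
  exact_mod_cast h n E hE

lemma le_sepPn [CompactSpace X] {f : C(X, ℝ)} (hδ : 0 < δ) {E : Finset X} (hEK : ↑E ⊆ K)
    (hE : IsSep T n δ E) : ∑ x ∈ E, Real.exp (birk T f n x) ≤ sepPn T f n δ K := by
  obtain ⟨C, -, h⟩ := exists_forall_isSep_sum_le T f hδ
  refine le_csSup ⟨Real.exp (n * C), ?_⟩ ⟨E, hEK, hE, rfl⟩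
  rintro _ ⟨E, -, hE, rfl⟩
  exact h n E hE

lemma sepPn_le {f : X → ℝ} {c : ℝ}
    (h : ∀ E : Finset X, ↑E ⊆ K → IsSep T n δ E → ∑ x ∈ E, Real.exp (birk T f n x) ≤ c) :
    sepPn T f n δ K ≤ c := by
  refine csSup_le ⟨_, ∅, by simp, by simp, rfl⟩ ?_
  rintro _ ⟨E, hEK, hE, rfl⟩
  exact h E hEK hE

lemma exists_lt_sum_of_lt_sepPn {f : X → ℝ} {c : ℝ} (h : c < sepPn T f n δ K) :
    ∃ E : Finset X, ↑E ⊆ K ∧ IsSep T n δ E ∧ c < ∑ x ∈ E, Real.exp (birk T f n x) := by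
  by_contra! hc
  exact h.not_ge (sepPn_le hc)

lemma sepPn_pos [CompactSpace X] {f : C(X, ℝ)} (hδ : 0 < δ) (hK : K.Nonempty) :
    0 < sepPn T f n δ K := by
  obtain ⟨x, hx⟩ := hK
  refine lt_of_lt_of_le ?_ (le_sepPn (E := {x}) hδ (by simpa using hx)
    fun a ha b hb hab => (hab ?_).elim)
  · simpa using Real.exp_pos _
  · rw [Finset.mem_singleton.1 ha, Finset.mem_singleton.1 hb]

lemma pres_mono [CompactSpace X] (T : X → X) (f : C(X, ℝ)) {K K' : Set X} (hK : K.Nonempty)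
    (h : K ⊆ K') : pres T f K ≤ pres T f K' := by
  refine iSup₂_mono fun δ hδ => limsup_le_limsup (Eventually.of_forall fun n => ?_)
  refine EReal.coe_le_coe_iff.2 (div_le_div_of_nonneg_right ?_ n.cast_nonneg)
  refine Real.log_le_log (sepPn_pos hδ hK) (sepPn_le fun E hEK hE => ?_)
  exact le_sepPn hδ (hEK.trans h) hE

lemma exists_isSep_spanning [CompactSpace X] (T : X → X) (n : ℕ) (hδ : 0 < δ) (K : Set X) :
    ∃ E : Finset X, ↑E ⊆ K ∧ IsSep T n δ E ∧
      ∀ x ∈ K, ∃ e ∈ E, ∀ i < n, dist (T^[i] x) (T^[i] e) ≤ δ := by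
  classical
  obtain ⟨C, -, hC⟩ := exists_card_le_of_isSep T hδ
  let A : Set ℕ := {k | ∃ E : Finset X, ↑E ⊆ K ∧ IsSep T n δ E ∧ E.card = k}
  have hA : BddAbove A := ⟨C ^ n, by rintro _ ⟨E, -, hE, rfl⟩; exact hC n E hE⟩
  have hne : A.Nonempty := ⟨0, ∅, by simp, fun _ h => by simp at h, rfl⟩
  obtain ⟨E, hEK, hE, hcard⟩ := Nat.sSup_mem hne hA
  refine ⟨E, hEK, hE, fun x hx => ?_⟩
  by_contra! hfar
  have hxE : x ∉ E := fun h => by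
    obtain ⟨i, -, hi⟩ := hfar x h
    rw [dist_self] at hi
    exact hi.not_ge hδ.le
  have hsep : IsSep T n δ (insert x E) := by
    intro a ha' b hb' hab
    rcases Finset.mem_insert.1 ha' with rfl | ha <;> rcases Finset.mem_insert.1 hb' with rfl | hb
    · exact (hab rfl).elim
    · exact hfar b hb
    · obtain ⟨i, hi, h⟩ := hfar a ha
      exact ⟨i, hi, by rwa [dist_comm]⟩
    · exact hE a ha b hb hab
  have : E.card + 1 ≤ sSup A := le_csSup hA ⟨insert x E, by
    rw [Finset.coe_insert]; exact insert_subset hx hEK, hsep, Finset.card_insert_of_notMem hxE⟩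
  omega

end Separated

section Gibbs

open Classical Real

lemma negMulLog_add_mul_le {p a Z : ℝ} (hp : 0 ≤ p) (hZ : 0 < Z) :
    negMulLog p + p * a ≤ p * log Z + exp a / Z - p := by
  rcases hp.eq_or_lt with rfl | hp
  · simp only [negMulLog_zero, zero_mul, zero_add, sub_zero]
    positivity
  · have h := log_le_sub_one_of_pos (show 0 < exp a / (Z * p) by positivity)
    rw [log_div (exp_ne_zero a) (by positivity), log_exp, log_mul hZ.ne' hp.ne'] at h
    have h2 := mul_le_mul_of_nonneg_left h hp.le
    have h3 : p * (exp a / (Z * p) - 1) = exp a / Z - p := by field_simp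
    rw [negMulLog]
    linarith

/-- The Gibbs inequality. -/
lemma sum_negMulLog_add_le_log_sum_exp {ι : Type*} (s : Finset ι) (p a : ι → ℝ)
    (hp : ∀ i ∈ s, 0 ≤ p i) (hs : ∑ i ∈ s, p i = 1) :
    ∑ i ∈ s, (negMulLog (p i) + p i * a i) ≤ log (∑ i ∈ s, exp (a i)) := by
  have hne : s.Nonempty := by
    by_contra h
    simp [Finset.not_nonempty_iff_eq_empty.1 h] at hs
  have hZ : 0 < ∑ i ∈ s, exp (a i) := Finset.sum_pos (fun i _ => exp_pos _) hne
  refine (Finset.sum_le_sum fun i hi => negMulLog_add_mul_le (hp i hi) hZ).trans_eq ?_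
  rw [Finset.sum_sub_distrib, Finset.sum_add_distrib, ← Finset.sum_mul, ← Finset.sum_div, hs,
    div_self hZ.ne']
  ring

variable [MeasurableSpace X]

/-- The Gibbs measure on a finite set `E` separated by `S` attains the Gibbs inequality. -/
lemma exists_gibbs_measure {E : Finset X} (hE : E.Nonempty) (a : X → ℝ) (ha : Measurable a) :
    ∃ ν : Measure X, IsProbabilityMeasure ν ∧ ∀ S : Finset (MSet X),
      (∀ x ∈ E, ∀ y ∈ E, (∀ A ∈ S, x ∈ A.1 ↔ y ∈ A.1) → x = y) →
      log (∑ x ∈ E, exp (a x)) - ∫ x, a x ∂ν ≤ ent ν S := by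
  set Z := ∑ x ∈ E, exp (a x) with hZdef
  have hZ : 0 < Z := Finset.sum_pos (fun i _ => exp_pos _) hE
  let w : X → ℝ := fun x => exp (a x) / Z
  have hw : ∀ x, 0 ≤ w x := fun x => by positivity
  have hw1 : ∑ x ∈ E, w x = 1 := by
    simp only [w]
    rw [← Finset.sum_div, div_self hZ.ne']
  let ν : Measure X := ∑ x ∈ E, ENNReal.ofReal (w x) • Measure.dirac x
  have hprob : IsProbabilityMeasure ν := ⟨by
    simp only [ν, Measure.coe_finsetSum, Finset.sum_apply, Measure.smul_apply, measure_univ,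
      smul_eq_mul, mul_one]
    rw [← ENNReal.ofReal_sum_of_nonneg fun i _ => hw i, hw1, ENNReal.ofReal_one]⟩
  refine ⟨ν, hprob, fun S hS => ?_⟩
  have hint : ∫ x, a x ∂ν = ∑ x ∈ E, w x * a x := by
    simp only [ν]
    rw [integral_finsetSum_measure fun x _ => ((integrable_dirac' ha.stronglyMeasurable
      (by simp)).smul_measure ENNReal.ofReal_ne_top)]
    refine Finset.sum_congr rfl fun x _ => ?_
    rw [integral_smul_measure, integral_dirac' _ _ ha.stronglyMeasurable,
      ENNReal.toReal_ofReal (hw x), smul_eq_mul]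
  have hcell : ∀ x ∈ E, ν.real (cell S (S.filter fun A => x ∈ A.1)) = w x := by
    intro x hx
    rw [measureReal_def]
    simp only [ν, Measure.coe_finsetSum, Finset.sum_apply, Measure.smul_apply, smul_eq_mul]
    rw [Finset.sum_eq_single_of_mem x hx, Measure.dirac_apply' _ (measurableSet_cell _ _),
      indicator_of_mem (mem_cell_filter S x), Pi.one_apply, mul_one, ENNReal.toReal_ofReal (hw x)]
    intro y hy hyx
    rw [Measure.dirac_apply' _ (measurableSet_cell _ _), indicator_of_notMem, mul_zero]
    intro hmem
    refine hyx (hS y hy x hx fun A hA => (hmem A hA).trans ?_)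
    simp [hA]
  have hle : ∑ x ∈ E, negMulLog (w x) ≤ ent ν S := by
    rw [show ∑ x ∈ E, negMulLog (w x) =
        ∑ x ∈ E, negMulLog (ν.real (cell S (S.filter fun A => x ∈ A.1))) from
        Finset.sum_congr rfl fun x hx => by rw [hcell x hx],
      ← Finset.sum_image (f := fun R => negMulLog (ν.real (cell S R)))
        (g := fun x => S.filter fun A => x ∈ A.1)]
    · refine Finset.sum_le_sum_of_subset_of_nonneg ?_ fun R _ _ =>
        negMulLog_nonneg measureReal_nonneg measureReal_le_one
      intro R hR
      obtain ⟨x, -, rfl⟩ := Finset.mem_image.1 hR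
      exact Finset.mem_powerset.2 (Finset.filter_subset _ _)
    · intro x hx y hy hxy
      refine hS x hx y hy fun A hA => ?_
      have := Finset.ext_iff.1 hxy A
      simpa [hA] using this
  refine le_trans (le_of_eq ?_) hle
  have : ∀ x ∈ E, negMulLog (w x) = w x * log Z - w x * a x := by
    intro x _
    rw [negMulLog, log_div (exp_ne_zero _) hZ.ne', log_exp]
    ring
  rw [Finset.sum_congr rfl this, Finset.sum_sub_distrib, ← Finset.sum_mul, hw1, hint, one_mul]

/-- Cesàro averages of the orbit of a measure. -/
lemma exists_average_measure (T : X → X) (hT : Measurable T) (ν : Measure X)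
    [IsProbabilityMeasure ν] {n : ℕ} (hn : 0 < n) :
    ∃ μ : Measure X, IsProbabilityMeasure μ ∧
      (∀ A, n * μ.real A = ∑ i ∈ Finset.range n, (ν.map T^[i]).real A) ∧
      ∀ g : X → ℝ, Measurable g → (∃ C, ∀ x, ‖g x‖ ≤ C) →
        n * ∫ x, g x ∂μ = ∫ x, birk T g n x ∂ν := by
  have hprob : ∀ i, IsProbabilityMeasure (ν.map T^[i]) := fun i =>
    Measure.isProbabilityMeasure_map (hT.iterate i).aemeasurable
  have hn0 : (n : ENNReal) ≠ 0 := by exact_mod_cast hn.ne'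
  have hn' : (n : ℝ) ≠ 0 := by exact_mod_cast hn.ne'
  let μ : Measure X := (n : ENNReal)⁻¹ • ∑ i ∈ Finset.range n, ν.map T^[i]
  refine ⟨μ, ⟨?_⟩, ?_, ?_⟩
  · simp only [μ, Measure.smul_apply, Measure.coe_finsetSum, Finset.sum_apply, measure_univ,
      smul_eq_mul, Finset.sum_const, Finset.card_range, nsmul_eq_mul, mul_one]
    exact ENNReal.inv_mul_cancel hn0 (ENNReal.natCast_ne_top n)
  · intro A
    simp only [measureReal_def, μ, Measure.smul_apply, Measure.coe_finsetSum, Finset.sum_apply,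
      smul_eq_mul, ENNReal.toReal_mul, ENNReal.toReal_inv, ENNReal.toReal_natCast]
    rw [mul_inv_cancel_left₀ hn', ENNReal.toReal_sum fun i _ => measure_ne_top _ _]
  · rintro g hg ⟨C, hC⟩
    have hint : ∀ (m : Measure X) [IsProbabilityMeasure m], Integrable g m := fun m _ =>
      .of_bound hg.aestronglyMeasurable C (.of_forall hC)
    simp only [μ]
    rw [integral_smul_measure, integral_finsetSum_measure fun i _ => hint _, ENNReal.toReal_inv,
      ENNReal.toReal_natCast, smul_eq_mul, mul_inv_cancel_left₀ hn']
    unfold birk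
    rw [integral_finsetSum]
    · refine Finset.sum_congr rfl fun i _ => ?_
      rw [integral_map (hT.iterate i).aemeasurable hg.aestronglyMeasurable]
    · exact fun i _ => .of_bound (hg.comp (hT.iterate i)).aestronglyMeasurable C
        (.of_forall fun _ => hC _)

lemma ent_blk_add_le (T : X ≃ᵐ X) (S : Finset (MSet X)) (q n : ℕ) (ν : Measure X)
    [IsProbabilityMeasure ν] :
    ent ν (blk (prePerm T) S (n + q)) ≤ ∑ i ∈ Finset.range n,
      (ent (ν.map T^[i]) (S ∪ (blk (prePerm T) S q).image (prePerm T)) -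
        ent (ν.map T^[i]) ((blk (prePerm T) S q).image (prePerm T))) +
      (blk (prePerm T) S q).card * log 2 := by
  induction n generalizing ν with
  | zero => simpa using ent_le_card ν _
  | succ n ih =>
    have hν : IsProbabilityMeasure (ν.map T) :=
      Measure.isProbabilityMeasure_map T.measurable.aemeasurable
    have h1 := ih (ν.map T)
    rw [Finset.sum_range_succ', Nat.add_right_comm, blk_succ]
    have h2 := (isPolymatroid_ent ν).submod S ((blk (prePerm T) S q).image (prePerm T))
      ((blk (prePerm T) S (n + q)).image (prePerm T))
      (Finset.image_subset_image (blk_mono S (Nat.le_add_left q n)))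
    rw [ent_image_prePerm ν T (blk (prePerm T) S (n + q))] at h2
    have h3 : ∀ i, (ν.map T).map T^[i] = ν.map T^[i + 1] := fun i => by
      rw [Measure.map_map (T.measurable.iterate i) T.measurable, Function.iterate_succ]
    simp only [h3] at h1
    simp only [Function.iterate_zero, Measure.map_id]
    linarith

lemma le_rate_of_forall_blk {M : Type*} {H : Finset M → ℝ} (hH : IsPolymatroid H)
    {τ : Equiv.Perm M} {S : Finset M} {c : ℝ}
    (h : ∀ q, c ≤ H (S ∪ (blk τ S q).image τ) - H ((blk τ S q).image τ)) : c ≤ rate H τ S := by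
  refine IsPolymatroid.le_condH fun W hW => ?_
  have : ∃ q, W ⊆ (blk τ S q).image τ := by
    clear h
    induction W using Finset.induction_on with
    | empty => exact ⟨0, by simp⟩
    | insert a W _ ih =>
      rw [Finset.coe_insert, insert_subset_iff] at hW
      obtain ⟨q, hq⟩ := ih hW.2
      obtain ⟨m, hm, b, hb, rfl⟩ := hW.1
      refine ⟨max q m, Finset.insert_subset ?_ (hq.trans
        (Finset.image_subset_image (blk_mono S (le_max_left q m))))⟩
      refine Finset.mem_image.2 ⟨(τ ^ (m - 1)) b, mem_blk.2 ⟨m - 1, by omega, b, hb, rfl⟩, ?_⟩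
      rw [← Equiv.Perm.mul_apply, ← pow_succ', Nat.sub_add_cancel hm]
  obtain ⟨q, hq⟩ := this
  linarith [h q, hH.submod S _ _ hq]

end Gibbs

section Variational

open Classical Real

lemma notMem_frontier_of_eventually_iff [TopologicalSpace X] {s : Set X} {x : X}
    (h : ∀ᶠ y in 𝓝 x, (y ∈ s ↔ x ∈ s)) : x ∉ frontier s := by
  by_cases hx : x ∈ s
  · have : s ∈ 𝓝 x := h.mono fun y hy => hy.2 hx
    exact fun hf => hf.2 (mem_interior_iff_mem_nhds.2 this)
  · have : sᶜ ∈ 𝓝 x := h.mono fun y hy hys => hx (hy.1 hys)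
    rw [← frontier_compl]
    exact fun hf => hf.2 (mem_interior_iff_mem_nhds.2 this)

lemma eventually_iff_of_notMem_frontier [TopologicalSpace X] {s : Set X} {x : X}
    (h : x ∉ frontier s) : ∀ᶠ y in 𝓝 x, (y ∈ s ↔ x ∈ s) := by
  by_cases hx : x ∈ s
  · have : x ∈ interior s := by
      by_contra hi
      exact h ⟨subset_closure hx, hi⟩
    exact Eventually.mono (mem_interior_iff_mem_nhds.1 this) fun y hy => by
      simp [hx, show y ∈ s from hy]
  · have : x ∈ interior sᶜ := by
      by_contra hi
      rw [← frontier_compl] at h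
      exact h ⟨subset_closure hx, hi⟩
    exact Eventually.mono (mem_interior_iff_mem_nhds.1 this) fun y hy => by
      simp [hx, show y ∉ s from hy]

lemma measure_frontier_cell [TopologicalSpace X] [MeasurableSpace X] {μ : Measure X}
    {S : Finset (MSet X)} (h : ∀ A ∈ S, μ (frontier A.1) = 0) (R : Finset (MSet X)) :
    μ (frontier (cell S R)) = 0 := by
  refine measure_mono_null (t := ⋃ A ∈ S, frontier A.1) (fun x hx => ?_)
    ((measure_biUnion_null_iff S.countable_toSet).2 h)
  by_contra hne
  simp only [mem_iUnion, not_exists] at hne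
  refine notMem_frontier_of_eventually_iff ?_ hx
  have := (Finset.eventually_all S).2 fun A hA => eventually_iff_of_notMem_frontier (hne A hA)
  filter_upwards [this] with y hy
  exact forall₂_congr fun A hA => by rw [hy A hA]

variable [MetricSpace X] [MeasurableSpace X] [BorelSpace X]

lemma tendsto_ent {ι : Type*} {L : Filter ι} {μ : ProbabilityMeasure X}
    {μs : ι → ProbabilityMeasure X} (h : Tendsto μs L (𝓝 μ)) {S : Finset (MSet X)}
    (hS : ∀ A ∈ S, (μ : Measure X) (frontier A.1) = 0) :
    Tendsto (fun i => ent (μs i : Measure X) S) L (𝓝 (ent (μ : Measure X) S)) := by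
  refine tendsto_finsetSum _ fun R _ => continuous_negMulLog.continuousAt.tendsto.comp ?_
  exact (ENNReal.tendsto_toReal (measure_ne_top _ _)).comp
    (ProbabilityMeasure.tendsto_measure_of_null_frontier_of_tendsto' h
      (measure_frontier_cell hS R))

variable [CompactSpace X]

lemma tendsto_integral_continuousMap {ι : Type*} {L : Filter ι} {μ : ProbabilityMeasure X}
    {μs : ι → ProbabilityMeasure X} (h : Tendsto μs L (𝓝 μ)) (g : C(X, ℝ)) :
    Tendsto (fun i => ∫ x, g x ∂(μs i : Measure X)) L (𝓝 (∫ x, g x ∂(μ : Measure X))) :=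
  ProbabilityMeasure.tendsto_iff_forall_integral_tendsto.1 h
    (BoundedContinuousFunction.mkOfCompact g)

lemma exists_null_frontier_cover (μ : Measure X) [IsFiniteMeasure μ] {δ : ℝ} (hδ : 0 < δ) :
    ∃ α : Finset (MSet X), (∀ A ∈ α, μ (frontier A.1) = 0) ∧
      ∀ x y, δ < dist x y → ∃ A ∈ α, x ∈ A.1 ∧ y ∉ A.1 := by
  have : ∀ x : X, ∃ r ∈ Ioo 0 (δ / 2), μ (frontier (Metric.ball x r)) = 0 := fun x => by
    simpa using exists_null_frontier_thickening μ {x} (half_pos hδ)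
  choose r hr hnull using this
  obtain ⟨t, -, ht⟩ := isCompact_univ.elim_nhds_subcover (fun x : X => Metric.ball x (r x))
    (fun x _ => Metric.ball_mem_nhds x (hr x).1)
  refine ⟨t.image fun x => ⟨Metric.ball x (r x), measurableSet_ball⟩, ?_, fun x y hxy => ?_⟩
  · simp only [Finset.forall_mem_image]
    exact fun x _ => hnull x
  · obtain ⟨c, hc, hx⟩ := mem_iUnion₂.1 (ht (mem_univ x))
    refine ⟨_, Finset.mem_image_of_mem _ hc, hx, fun hy => ?_⟩
    have h1 := dist_triangle_right x y c
    have h2 := (hr c).2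
    rw [Metric.mem_ball] at hx hy
    linarith

/-- An invariant measure whose entropy rate on some finite family of sets, plus the integral of
the potential, is at least a given constant below the pressure. -/
theorem exists_le_rate_add_integral [Nonempty X] (T : X ≃ₜ X) (f : C(X, ℝ)) {c : ℝ}
    (hc : (c : EReal) < pres T f univ) :
    ∃ μ : Measure X, IsProbabilityMeasure μ ∧ μ.map T = μ ∧ ∃ α : Finset (MSet X),
      c ≤ rate (ent μ) (prePerm T.toMeasurableEquiv) α + ∫ x, f x ∂μ := by
  obtain ⟨δ, hc⟩ := lt_iSup_iff.1 hc
  obtain ⟨hδ, hc⟩ := lt_iSup_iff.1 hc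
  have hfreq := frequently_lt_of_lt_limsup (by isBoundedDefault) hc
  have hfreq : ∃ᶠ n : ℕ in atTop, 0 < n ∧ c * n < Real.log (sepPn T f n δ univ) := by
    refine (hfreq.and_eventually (eventually_gt_atTop 0)).mono fun n hn => ⟨hn.2, ?_⟩
    have h1 := EReal.coe_lt_coe_iff.1 hn.1
    rwa [lt_div_iff₀ (by exact_mod_cast hn.2)] at h1
  set TT := T.toMeasurableEquiv with hTT
  have hTm : Measurable T := T.measurable
  have hex : ∀ n : ℕ, ∃ ν μ : ProbabilityMeasure X,
      (0 < n ∧ c * n < Real.log (sepPn T f n δ univ)) →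
      ((∀ A, n * (μ : Measure X).real A =
        ∑ i ∈ Finset.range n, ((ν : Measure X).map T^[i]).real A) ∧
      (∀ g : C(X, ℝ), n * ∫ x, g x ∂(μ : Measure X) = ∫ x, birk T g n x ∂(ν : Measure X)) ∧
      ∀ S : Finset (MSet X), (∀ x y, δ < dist x y → ∃ A ∈ S, x ∈ A.1 ∧ y ∉ A.1) →
        c * n ≤ ent (ν : Measure X) (blk (prePerm TT) S n) + n * ∫ x, f x ∂(μ : Measure X)) := by
    intro n
    by_cases hn : 0 < n ∧ c * n < Real.log (sepPn T f n δ univ)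
    swap
    · obtain ⟨x⟩ := ‹Nonempty X›
      exact ⟨⟨Measure.dirac x, inferInstance⟩, ⟨Measure.dirac x, inferInstance⟩,
        fun h => (hn h).elim⟩
    obtain ⟨hn0, hn⟩ := hn
    rw [Real.lt_log_iff_exp_lt (sepPn_pos hδ univ_nonempty)] at hn
    obtain ⟨E, -, hE, hlt⟩ := exists_lt_sum_of_lt_sepPn hn
    have hEne : E.Nonempty := by
      by_contra h
      rw [Finset.not_nonempty_iff_eq_empty.1 h, Finset.sum_empty] at hlt
      exact (Real.exp_pos _).not_gt hlt
    have hbm : Measurable (birk T f n) := by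
      unfold birk
      exact Finset.measurable_sum _ fun i _ => f.continuous.measurable.comp (hTm.iterate i)
    obtain ⟨ν, hν, hgibbs⟩ := exists_gibbs_measure hEne (birk T f n) hbm
    obtain ⟨μ, hμ, havg, hint⟩ := exists_average_measure T hTm ν hn0
    have hint' : ∀ g : C(X, ℝ), n * ∫ x, g x ∂μ = ∫ x, birk T g n x ∂ν := fun g =>
      hint g g.continuous.measurable ⟨‖g‖, g.norm_coe_le_norm⟩
    refine ⟨⟨ν, hν⟩, ⟨μ, hμ⟩, fun _ => ⟨havg, hint', fun S hS => ?_⟩⟩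
    have h1 := hgibbs (blk (prePerm TT) S n) fun x hx y hy hxy => ?_
    · have h2 := (Real.lt_log_iff_exp_lt (Finset.sum_pos (fun i _ => Real.exp_pos _) hEne)).2 hlt
      simp only [ProbabilityMeasure.coe_mk]
      rw [hint' f]
      linarith
    · by_contra hne
      obtain ⟨i, hi, hd⟩ := hE x hx y hy hne
      obtain ⟨A, hA, h1, h2⟩ := hS _ _ hd
      have := hxy _ (mem_blk.2 ⟨i, hi, A, hA, rfl⟩)
      rw [prePerm_pow_apply] at this
      exact h2 (this.1 h1)
  choose ν μs hμs using hex
  let L : Filter ℕ := atTop ⊓ 𝓟 {n | 0 < n ∧ c * n < Real.log (sepPn T f n δ univ)}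
  have hL : NeBot L := frequently_mem_iff_neBot.1 hfreq
  let U := Ultrafilter.of L
  have hUL : (U : Filter ℕ) ≤ L := Ultrafilter.of_le L
  have hUtop : Tendsto (fun n : ℕ => n) U atTop := hUL.trans inf_le_left
  have hUgood : ∀ᶠ n in (U : Filter ℕ), 0 < n ∧ c * n < Real.log (sepPn T f n δ univ) :=
    hUL (mem_inf_of_right (mem_principal_self _))
  obtain ⟨μ, -, hμlim⟩ := isCompact_univ.ultrafilter_le_nhds (U.map μs) (by simp)
  have hlim : Tendsto μs U (𝓝 μ) := hμlim
  have hinv : (μ : Measure X).map T = μ := by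
    have : IsProbabilityMeasure ((μ : Measure X).map T) :=
      Measure.isProbabilityMeasure_map hTm.aemeasurable
    refine ext_of_forall_integral_eq_of_IsFiniteMeasure fun g => ?_
    rw [integral_map hTm.aemeasurable g.continuous.aestronglyMeasurable]
    let g₁ : C(X, ℝ) := g.toContinuousMap
    let g₂ : C(X, ℝ) := g₁.comp ⟨T, T.continuous⟩
    have hsub := (tendsto_integral_continuousMap hlim g₂).sub
      (tendsto_integral_continuousMap hlim g₁)
    have hzero : Tendsto (fun n => ∫ x, g₂ x ∂(μs n : Measure X) - ∫ x, g₁ x ∂(μs n : Measure X))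
        U (𝓝 0) := by
      have hb : Tendsto (fun n : ℕ => 2 * ‖g₁‖ / n) U (𝓝 0) :=
        (tendsto_const_div_atTop_nhds_zero_nat (2 * ‖g₁‖)).comp hUtop
      refine squeeze_zero_norm' ?_ hb
      filter_upwards [hUgood] with n hn
      have hn0 : (0 : ℝ) < n := by exact_mod_cast hn.1
      rw [le_div_iff₀ hn0, ← Real.norm_of_nonneg hn0.le, ← norm_mul, sub_mul,
        mul_comm _ (n : ℝ), mul_comm _ (n : ℝ), (hμs n hn).2.1, (hμs n hn).2.1, ← integral_sub]
      · have : ∀ x, birk T g₂ n x - birk T g₁ n x = g₁ (T^[n] x) - g₁ x := by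
          intro x
          unfold birk
          rw [← Finset.sum_sub_distrib]
          have : ∀ j, g₂ (T^[j] x) = g₁ (T^[j + 1] x) := fun j => by
            rw [Function.iterate_succ_apply']; rfl
          simp only [this]
          rw [Finset.sum_range_sub (fun j => g₁ (T^[j] x))]
          rfl
        simp only [this]
        refine (norm_integral_le_of_norm_le_const (C := 2 * ‖g₁‖) (.of_forall fun x => ?_)).trans ?_
        · refine (norm_sub_le _ _).trans ?_
          linarith [g₁.norm_coe_le_norm x, g₁.norm_coe_le_norm (T^[n] x)]
        · simp
      · have : Continuous (birk T g₂ n) := by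
          unfold birk
          exact continuous_finsetSum _ fun i _ => g₂.continuous.comp (T.continuous.iterate i)
        exact this.integrable_of_hasCompactSupport (HasCompactSupport.of_compactSpace _)
      · have : Continuous (birk T g₁ n) := by
          unfold birk
          exact continuous_finsetSum _ fun i _ => g₁.continuous.comp (T.continuous.iterate i)
        exact this.integrable_of_hasCompactSupport (HasCompactSupport.of_compactSpace _)
    exact sub_eq_zero.1 (tendsto_nhds_unique hsub hzero)
  refine ⟨μ, inferInstance, hinv, ?_⟩
  obtain ⟨α, hα, hsep⟩ := exists_null_frontier_cover (μ : Measure X) hδ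
  refine ⟨α, ?_⟩
  rw [← sub_le_iff_le_add]
  refine le_rate_of_forall_blk (isPolymatroid_ent _) fun q => ?_
  set W := (blk (prePerm TT) α q).image (prePerm TT)
  have hfr : ∀ A ∈ W, (μ : Measure X) (frontier A.1) = 0 := by
    have hstep : ∀ A : MSet X, (μ : Measure X) (frontier A.1) = 0 →
        (μ : Measure X) (frontier (prePerm TT A).1) = 0 := by
      intro A hA
      change (μ : Measure X) (frontier (T ⁻¹' A.1)) = 0
      rw [← T.preimage_frontier, ← Measure.map_apply hTm isClosed_frontier.measurableSet, hinv, hA]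
    have hpow : ∀ i, ∀ A ∈ α, (μ : Measure X) (frontier ((prePerm TT ^ i) A).1) = 0 := by
      intro i A hA
      induction i with
      | zero => exact hα A hA
      | succ i ih =>
        rw [pow_succ']
        exact hstep _ ih
    intro A hA
    obtain ⟨B, hB, rfl⟩ := Finset.mem_image.1 hA
    obtain ⟨i, -, A, hA', rfl⟩ := mem_blk.1 hB
    exact hstep _ (hpow i A hA')
  have hfr' : ∀ A ∈ α ∪ W, (μ : Measure X) (frontier A.1) = 0 := fun A hA =>
    (Finset.mem_union.1 hA).elim (hα A) (hfr A)
  have hconst : Tendsto (fun n : ℕ => ((blk (prePerm TT) α q).card * Real.log 2) / n) U (𝓝 0) :=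
    (tendsto_const_div_atTop_nhds_zero_nat _).comp hUtop
  have hl := (((tendsto_ent hlim hfr').sub (tendsto_ent hlim hfr)).add hconst).add
    (tendsto_integral_continuousMap hlim f)
  rw [add_zero] at hl
  rw [sub_le_iff_le_add]
  refine ge_of_tendsto hl ?_
  filter_upwards [hUgood] with n hn
  have hn0 : (0 : ℝ) < n := by exact_mod_cast hn.1
  obtain ⟨havg, -, hent⟩ := hμs n hn
  have h1 := hent α hsep
  have h2 := (isPolymatroid_ent (ν n : Measure X)).mono _ _
    (blk_mono (τ := prePerm TT) α (Nat.le_add_right n q))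
  have h3 := ent_blk_add_le TT α q n (ν n : Measure X)
  have : ∀ i, IsFiniteMeasure ((ν n : Measure X).map TT^[i]) := fun i => inferInstance
  have h4 := sum_ent_sub_le_of_average (μs n : Measure X)
    (fun i => (ν n : Measure X).map TT^[i]) (fun A _ => havg A) α W
  have h5 : c * n ≤ (ent (μs n : Measure X) (α ∪ W) - ent (μs n : Measure X) W +
      (blk (prePerm TT) α q).card * Real.log 2 / n + ∫ x, f x ∂(μs n : Measure X)) * n := by
    rw [add_mul, add_mul, div_mul_cancel₀ _ hn0.ne']
    linarith
  exact le_of_mul_le_mul_right h5 hn0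

end Variational

section Pinsker

open Classical ProbabilityTheory

section Kernel

variable {m mX : MeasurableSpace X} [StandardBorelSpace X] {μ : Measure X} [IsFiniteMeasure μ]
  {s t : Set X}

lemma setLIntegral_condExpKernel (hm : m ≤ mX) (hs : MeasurableSet s) (ht : MeasurableSet[m] t) :
    ∫⁻ x in t, condExpKernel μ m x s ∂μ = μ (s ∩ t) := by
  have h := congrArg (fun ρ : @Measure (X × X) (m.prod mX) => ρ (t ×ˢ s))
    (compProd_trim_condExpKernel (μ := μ) hm)
  beta_reduce at h
  have hts : @MeasurableSet _ (m.prod mX) (t ×ˢ s) := @MeasurableSet.prod _ _ m mX _ _ ht hs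
  have hd : @Measurable X (X × X) mX (m.prod mX) Function.diag :=
    @Measurable.prodMk X mX X X m mX id id (measurable_id'' hm) measurable_id
  rw [Measure.map_apply hd hts, Measure.compProd_apply_prod ht hs, restrict_trim hm _ ht,
    lintegral_trim hm (measurable_condExpKernel hs)] at h
  rw [h, inter_comm]
  rfl

lemma condExpKernel_eq_zero_of_measure_inter_eq_zero (hm : m ≤ mX) (hs : MeasurableSet s)
    (ht : MeasurableSet[m] t) (h : μ (s ∩ t) = 0) :
    ∀ᵐ x ∂μ, x ∈ t → condExpKernel μ m x s = 0 := by
  rw [← setLIntegral_condExpKernel hm hs ht,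
    lintegral_eq_zero_iff ((measurable_condExpKernel hs).mono hm le_rfl)] at h
  exact (ae_restrict_iff' (hm _ ht)).1 h

lemma measure_inter_condExpKernel_eq_zero (hm : m ≤ mX) (hs : MeasurableSet s) :
    μ (s ∩ {x | condExpKernel μ m x s = 0}) = 0 := by
  have ht : MeasurableSet[m] {x | condExpKernel μ m x s = 0} :=
    measurable_condExpKernel hs (measurableSet_singleton 0)
  rw [← setLIntegral_condExpKernel hm hs ht]
  exact (setLIntegral_congr_fun (hm _ ht) fun x hx => hx).trans (by simp)

lemma condExpKernel_compl_eq_zero_of_mem (hm : m ≤ mX) (hs : MeasurableSet[m] s) :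
    ∀ᵐ x ∂μ, x ∈ s → condExpKernel μ m x sᶜ = 0 :=
  condExpKernel_eq_zero_of_measure_inter_eq_zero hm (hm _ hs).compl hs (by simp)

lemma condExpKernel_eq_zero_or_exists_mem_iff (hm : m ≤ mX) {𝒜 : Set (MSet X)}
    (h𝒜 : 𝒜.Countable) (hA : ∀ A ∈ 𝒜, MeasurableSet[m] A.1) (U : Set X) :
    ∀ᵐ x ∂μ, condExpKernel μ m x U = 0 ∨ ∃ y ∈ U, ∀ A ∈ 𝒜, x ∈ A.1 ↔ y ∈ A.1 := by
  have h : ∀ᵐ x ∂μ, ∀ A ∈ 𝒜, condExpKernel μ m x {y | ¬ (x ∈ A.1 ↔ y ∈ A.1)} = 0 := by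
    rw [ae_ball_iff h𝒜]
    intro A hA'
    filter_upwards [condExpKernel_compl_eq_zero_of_mem (μ := μ) hm (hA A hA'),
      condExpKernel_compl_eq_zero_of_mem (μ := μ) hm
        (@MeasurableSet.compl _ _ m (hA A hA'))] with x h1 h2
    by_cases hx : x ∈ A.1
    · convert h1 hx using 2
      ext; simp [hx]
    · convert h2 hx using 2
      ext; simp [hx]
  filter_upwards [h] with x hx
  refine or_iff_not_imp_left.2 fun h0 => ?_
  by_contra! hc
  refine h0 (measure_mono_null (t := ⋃ A ∈ 𝒜, {y | ¬ (x ∈ A.1 ↔ y ∈ A.1)}) ?_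
    ((measure_biUnion_null_iff h𝒜).2 hx))
  intro y hy
  obtain ⟨A, hA, h'⟩ := hc y hy
  simp only [mem_iUnion]
  exact ⟨A, hA, by simp only [mem_ofPred_eq]; tauto⟩

end Kernel

/-- Points with the same eventual itinerary through a base of the topology are asymptotic. -/
lemma mem_stableSet_of_forall_iff [MetricSpace X] [CompactSpace X] {T : X → X} {B : ℕ → Set X}
    (hB : TopologicalSpace.IsTopologicalBasis (range B)) {x y : X}
    (h : ∀ i, ∀ᶠ n in atTop, T^[n] x ∈ B i ↔ T^[n] y ∈ B i) : y ∈ stableSet T x := by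
  refine Metric.tendsto_atTop'.2 fun ε hε => ?_
  have hcov : ∀ z : X, ∃ i, z ∈ B i ∧ B i ⊆ Metric.ball z (ε / 2) := fun z => by
    obtain ⟨_, ⟨i, rfl⟩, hz, hs⟩ := hB.exists_subset_of_mem_open
      (Metric.mem_ball_self (half_pos hε)) Metric.isOpen_ball
    exact ⟨i, hz, hs⟩
  choose i hi hib using hcov
  obtain ⟨t, ht⟩ := isCompact_univ.elim_finite_subcover (fun z => B (i z))
    (fun z => hB.isOpen ⟨_, rfl⟩) (fun z _ => mem_iUnion.2 ⟨z, hi z⟩)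
  have h' : ∀ᶠ n in atTop, ∀ z ∈ t, T^[n] x ∈ B (i z) ↔ T^[n] y ∈ B (i z) :=
    (t.eventually_all).2 fun z _ => h (i z)
  obtain ⟨N, hN⟩ := eventually_atTop.1 h'
  refine ⟨N, fun n hn => ?_⟩
  obtain ⟨z, hz, hxz⟩ := mem_iUnion₂.1 (ht (mem_univ (T^[n] x)))
  have h1 := hib z hxz
  have h2 := hib z ((hN n hn.le z hz).1 hxz)
  rw [Metric.mem_ball] at h1 h2
  rw [dist_zero_right, Real.norm_of_nonneg dist_nonneg]
  linarith [dist_triangle_right (T^[n] x) (T^[n] y) z]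

lemma ent_image_eq_of_map_eq [MeasurableSpace X] {μ : Measure X} {T : X ≃ᵐ X} (hT : μ.map T = μ)
    (S : Finset (MSet X)) : ent μ (S.image (prePerm T)) = ent μ S := by
  rw [ent_image_prePerm, hT]

variable [MetricSpace X] [MeasurableSpace X] [BorelSpace X] {μ : Measure X}
  [IsProbabilityMeasure μ]

/-- The σ-algebra of sets with zero entropy rate. -/
@[reducible] def pinsker (μ : Measure X) [IsProbabilityMeasure μ] (T : X ≃ₜ X) :
    MeasurableSpace X :=
  clSigma μ {a | rate (ent μ) (prePerm T.toMeasurableEquiv) {a} = 0}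

lemma pinsker_le (T : X ≃ₜ X) : pinsker μ T ≤ ‹MeasurableSpace X› := clSigma_le μ _

lemma pinsker_symm {T : X ≃ₜ X} (hT : μ.map T = μ) : pinsker μ T.symm = pinsker μ T := by
  have hτ := ent_image_eq_of_map_eq (T := T.toMeasurableEquiv) hT
  have h : prePerm T.symm.toMeasurableEquiv = (prePerm T.toMeasurableEquiv)⁻¹ := rfl
  unfold pinsker
  congr 1
  ext a
  refine ⟨fun ha => ?_, fun ha => ?_⟩
  · exact (isPolymatroid_ent μ).rate_inv_eq_zero hτ ha
  · exact (isPolymatroid_ent μ).rate_inv_eq_zero (τ := prePerm T.symm.toMeasurableEquiv)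
      (rank_image_inv hτ) ha

/-- The conditional measures on the Pinsker algebra are supported by closures of stable sets. -/
theorem ae_condExpKernel_closure_stableSet [CompactSpace X] [StandardBorelSpace X]
    [SecondCountableTopology X] {T : X ≃ₜ X} (hT : μ.map T = μ) :
    ∀ᵐ x ∂μ, condExpKernel μ (pinsker μ T) x (closure (stableSet T x))ᶜ = 0 := by
  have hH := isPolymatroid_ent μ
  set τ := prePerm T.toMeasurableEquiv with hτdef
  have hτ := ent_image_eq_of_map_eq (T := T.toMeasurableEquiv) hT
  have hne : Nonempty X := nonempty_of_isProbabilityMeasure μ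
  obtain ⟨b, hbc, -, hb⟩ := TopologicalSpace.exists_countable_basis X
  obtain ⟨B, rfl⟩ := hbc.exists_eq_range (by
    obtain ⟨x⟩ := hne
    obtain ⟨v, hv, -⟩ := hb.exists_subset_of_mem_open (mem_univ x) isOpen_univ
    exact ⟨v, hv⟩)
  let U : ℕ → MSet X := fun i => ⟨B i, (hb.isOpen ⟨i, rfl⟩).measurableSet⟩
  have hUcl : ∀ a, a ∈ clH (ent μ) (orb τ (range U)) := by
    intro a
    have h1 := generateFrom_le_clSigma μ (orb τ (range U))
    have h2 : MeasurableSpace.generateFrom (range B) ≤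
        MeasurableSpace.generateFrom (MSet.val '' orb τ (range U)) := by
      refine MeasurableSpace.generateFrom_mono ?_
      rintro _ ⟨i, rfl⟩
      exact ⟨U i, ⟨0, U i, ⟨i, rfl⟩, rfl⟩, rfl⟩
    have h3 : ‹MeasurableSpace X› = MeasurableSpace.generateFrom (range B) :=
      (BorelSpace.measurable_eq (α := X)).trans hb.borel_eq_generateFrom
    obtain ⟨_, h⟩ := h1 _ (h2 _ (h3.le _ a.2))
    exact h
  obtain ⟨k, hk⟩ := hH.exists_shifts hτ U hUcl
  set V : ℕ → MSet X := fun i => (τ ^ k i) (U i) with hV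
  let 𝒜 : ℕ → Set (MSet X) := fun n => fut τ (range V) n
  have h𝒜c : ∀ n, (𝒜 n).Countable := fun n => by
    refine (countable_range fun p : ℕ × ℕ => (τ ^ p.1) (V p.2)).mono ?_
    rintro _ ⟨m, -, _, ⟨i, rfl⟩, rfl⟩
    exact ⟨(m, i), rfl⟩
  let 𝒢 : ℕ → MeasurableSpace X := fun n => MeasurableSpace.generateFrom (MSet.val '' 𝒜 n)
  have h𝒢 : ∀ n, 𝒢 n ≤ ‹MeasurableSpace X› := fun n => MeasurableSpace.generateFrom_le (by
    rintro _ ⟨A, -, rfl⟩; exact A.2)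
  have hanti : Antitone 𝒢 := fun m n hmn =>
    MeasurableSpace.generateFrom_mono (image_mono (fut_anti _ hmn))
  have hstab : ∀ n x y, (∀ A ∈ 𝒜 n, x ∈ A.1 ↔ y ∈ A.1) → y ∈ stableSet T x := by
    intro n x y h
    refine mem_stableSet_of_forall_iff hb fun i => eventually_atTop.2 ⟨n + k i, fun j hj => ?_⟩
    have := h ((τ ^ (j - k i)) (V i)) ⟨j - k i, by omega, V i, ⟨i, rfl⟩, rfl⟩
    rw [hV, ← Equiv.Perm.mul_apply, ← pow_add, Nat.sub_add_cancel (by omega),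
      prePerm_pow_apply] at this
    exact this
  have key : ∀ i, ∀ᵐ x ∂μ, condExpKernel μ (pinsker μ T) x (B i) = 0 ∨
      (B i ∩ stableSet T x).Nonempty := by
    intro i
    have hBi := (U i).2
    let H : ℕ → Set X := fun n => {x | condExpKernel μ (𝒢 n) x (B i) = 0}ᶜ
    have hHm : ∀ n, MeasurableSet[𝒢 n] (H n) := fun n =>
      @MeasurableSet.compl _ _ (𝒢 n) (measurable_condExpKernel hBi (measurableSet_singleton 0))
    let L : Set X := ⋂ N, ⋃ n, H (n + N)
    have hLm : ∀ N, MeasurableSet[𝒢 N] L := by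
      intro N
      have hL : L = ⋂ N', ⋃ n, H (n + (N' + N)) := by
        refine (Antitone.iInter_nat_add (f := fun N => ⋃ n, H (n + N)) ?_ N).symm
        intro a c hac
        refine iUnion_subset fun n => ?_
        refine (subset_iUnion (fun n => H (n + a)) (n + (c - a))).trans' (le_of_eq ?_)
        congr 1; omega
      rw [hL]
      exact @MeasurableSet.iInter _ _ (𝒢 N) _ _ fun N' => @MeasurableSet.iUnion _ _ (𝒢 N) _ _
        fun n => hanti (by omega) _ (hHm _)
    have hLX : MeasurableSet L := h𝒢 0 _ (hLm 0)
    have hrate : rate (ent μ) τ {⟨L, hLX⟩} = 0 := by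
      refine hk _ fun n => ?_
      obtain ⟨_, h⟩ := generateFrom_le_clSigma μ (𝒜 n) _ (hLm n)
      exact h
    have hLP : MeasurableSet[pinsker μ T] L := ⟨hLX, hH.subset_clH _ hrate⟩
    have hnull : μ (B i ∩ Lᶜ) = 0 := by
      refine measure_mono_null (t := ⋃ n, B i ∩ (H n)ᶜ) ?_ (measure_iUnion_null fun n => ?_)
      · rintro x ⟨hx, hxL⟩
        simp only [L, mem_compl_iff, mem_iInter, mem_iUnion, not_forall, not_exists] at hxL
        obtain ⟨N, hN⟩ := hxL
        exact mem_iUnion.2 ⟨_, hx, hN 0⟩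
      · simp only [H, compl_compl]
        exact measure_inter_condExpKernel_eq_zero (h𝒢 n) hBi
    have h1 := condExpKernel_eq_zero_of_measure_inter_eq_zero (pinsker_le T) hBi
      (@MeasurableSet.compl _ _ (pinsker μ T) hLP) hnull
    have h2 : ∀ᵐ x ∂μ, ∀ n, condExpKernel μ (𝒢 n) x (B i) = 0 ∨
        ∃ y ∈ B i, ∀ A ∈ 𝒜 n, x ∈ A.1 ↔ y ∈ A.1 := ae_all_iff.2 fun n =>
      condExpKernel_eq_zero_or_exists_mem_iff (h𝒢 n) (h𝒜c n)
        (fun A hA => MeasurableSpace.measurableSet_generateFrom ⟨A, hA, rfl⟩) _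
    filter_upwards [h1, h2] with x h1 h2
    by_cases hx : x ∈ L
    · right
      obtain ⟨n, hn⟩ := mem_iUnion.1 (mem_iInter.1 hx 0)
      obtain ⟨y, hy, hxy⟩ := (h2 _).resolve_left hn
      exact ⟨y, hy, hstab _ _ _ hxy⟩
    · exact Or.inl (h1 hx)
  filter_upwards [ae_all_iff.2 key] with x hx
  refine measure_mono_null (t := ⋃ i : {i // condExpKernel μ (pinsker μ T) x (B i) = 0}, B i) ?_
    (measure_iUnion_null fun i => i.2)
  intro y hy
  obtain ⟨_, ⟨i, rfl⟩, hyi, hi⟩ := hb.exists_subset_of_mem_open hy isClosed_closure.isOpen_compl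
  refine mem_iUnion.2 ⟨⟨i, (hx i).resolve_right ?_⟩, hyi⟩
  rintro ⟨z, hz, hz'⟩
  exact hi hz (subset_closure hz')

/-- The conditional measures on the Pinsker algebra are supported by intersections of closures of
stable and unstable sets. -/
theorem ae_condExpKernel_closure_inter_closure [CompactSpace X] [StandardBorelSpace X]
    [SecondCountableTopology X] {T : X ≃ₜ X} (hT : μ.map T = μ) :
    ∀ᵐ x ∂μ, condExpKernel μ (pinsker μ T) x
      (closure (stableSet T x) ∩ closure (stableSet T.symm x))ᶜ = 0 := by
  have hT' : μ.map T.symm = μ := by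
    conv_lhs => rw [← hT]
    rw [Measure.map_map T.symm.continuous.measurable T.continuous.measurable, T.symm_comp_self,
      Measure.map_id]
  have h := ae_condExpKernel_closure_stableSet hT'
  rw [pinsker_symm hT] at h
  filter_upwards [ae_condExpKernel_closure_stableSet hT, h] with x h1 h2
  rw [compl_inter]
  exact measure_union_null h1 h2

end Pinsker

section LocalEstimate

open Classical Real

variable [MeasurableSpace X]

lemma ent_le_sum_of_forall_exists_eq_cell (ν : Measure X) [IsProbabilityMeasure ν] {ι : Type*}
    (s : Finset ι) (D : ι → Set X) (S : Finset (MSet X))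
    (h : ∀ x, ∃ i ∈ s, D i = cell S (S.filter fun A => x ∈ A.1)) :
    ent ν S ≤ ∑ i ∈ s, negMulLog (ν.real (D i)) := by
  let Q := S.powerset.filter fun R => (cell S R).Nonempty
  have hQ : ∀ R ∈ Q, ∃ i ∈ s, D i = cell S R := by
    intro R hR
    obtain ⟨hRS, x, hx⟩ := Finset.mem_filter.1 hR
    obtain ⟨i, hi, h⟩ := h x
    exact ⟨i, hi, h.trans (by rw [cell_filter_eq (Finset.mem_powerset.1 hRS) hx])⟩
  have : Nonempty ι := by
    obtain ⟨x⟩ := nonempty_of_isProbabilityMeasure ν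
    exact ⟨(h x).choose⟩
  choose! i his hi using hQ
  have hinj : Set.InjOn i (Q : Set (Finset (MSet X))) := by
    intro R hR R' hR' hRR'
    obtain ⟨hRS, x, hx⟩ := Finset.mem_filter.1 (Finset.mem_coe.1 hR)
    obtain ⟨hRS', -⟩ := Finset.mem_filter.1 (Finset.mem_coe.1 hR')
    have hx' : x ∈ cell S R' := by rwa [← hi R' hR', ← hRR', hi R hR]
    rw [← cell_filter_eq (Finset.mem_powerset.1 hRS) hx,
      cell_filter_eq (Finset.mem_powerset.1 hRS') hx']
  calc ent ν S = ∑ R ∈ Q, negMulLog (ν.real (cell S R)) := by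
        refine (Finset.sum_subset (Finset.filter_subset _ _) fun R hR hRQ => ?_).symm
        have : cell S R = ∅ := by
          by_contra hne
          exact hRQ (Finset.mem_filter.2 ⟨hR, nonempty_iff_ne_empty.2 hne⟩)
        simp [this]
    _ = ∑ j ∈ Q.image i, negMulLog (ν.real (D j)) := by
        rw [Finset.sum_image hinj]
        exact Finset.sum_congr rfl fun R hR => by rw [hi R hR]
    _ ≤ _ := Finset.sum_le_sum_of_subset_of_nonneg (Finset.image_subset_iff.2 his)
        fun _ _ _ => negMulLog_nonneg measureReal_nonneg measureReal_le_one

lemma ent_image_le_of_partition (ν : Measure X) [IsProbabilityMeasure ν] {ι : Type*}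
    (E : Finset ι) (D : ι → MSet X) (h : ∀ x, ∃! e, e ∈ E ∧ x ∈ (D e).1) :
    ent ν (E.image D) ≤ ∑ e ∈ E, negMulLog (ν.real (D e).1) := by
  refine ent_le_sum_of_forall_exists_eq_cell ν E (fun e => (D e).1) _ fun x => ?_
  obtain ⟨e, ⟨he, hx⟩, huniq⟩ := h x
  refine ⟨e, he, ?_⟩
  ext y
  obtain ⟨e', ⟨he', hy⟩, huniq'⟩ := h y
  simp only [cell, Finset.mem_image, Finset.mem_filter, forall_exists_index, and_imp,
    forall_apply_eq_imp_iff₂, mem_ofPred_eq]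
  constructor
  · intro hye c hc
    obtain rfl : e = e' := huniq' e ⟨he, hye⟩
    refine ⟨fun h => ?_, fun h => ?_⟩
    · obtain rfl : c = e := huniq' c ⟨hc, h⟩
      exact ⟨⟨c, hc, rfl⟩, hx⟩
    · obtain rfl : c = e := huniq c ⟨hc, h.2⟩
      exact hy
  · intro hc
    exact (hc e he).2 ⟨⟨e, he, rfl⟩, hx⟩

/-- A finite family can be made into a partition. -/
lemma exists_partition {ι : Type*} {E : Finset ι} (hE : E.Nonempty) (B : ι → MSet X) :
    ∃ D : ι → MSet X, (∀ x, ∃! e, e ∈ E ∧ x ∈ (D e).1) ∧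
      ∀ x, (∃ e ∈ E, x ∈ (B e).1) → ∀ e ∈ E, x ∈ (D e).1 → x ∈ (B e).1 := by
  induction hE using Finset.Nonempty.cons_induction with
  | singleton a =>
    refine ⟨fun _ => ⟨univ, .univ⟩, fun x => ⟨a, by simp, fun e he => by simpa using he⟩, ?_⟩
    rintro x ⟨e, he, hx⟩ e' he' -
    rwa [Finset.mem_singleton.1 he', ← Finset.mem_singleton.1 he]
  | cons a s ha hs ih =>
    obtain ⟨D, hD, hDB⟩ := ih
    refine ⟨fun e => if e = a then B a else ⟨(D e).1 \ (B a).1, (D e).2.diff (B a).2⟩,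
      fun x => ?_, ?_⟩
    · by_cases hx : x ∈ (B a).1
      · refine ⟨a, by simp [hx], fun e he => ?_⟩
        by_contra hne
        simp [hne, hx] at he
      · obtain ⟨e, ⟨he, hxe⟩, hu⟩ := hD x
        have hea : e ≠ a := fun h => ha (h ▸ he)
        refine ⟨e, by simp [hea, he, hxe, hx], fun c hc => ?_⟩
        by_cases hca : c = a
        · simp [hca, hx] at hc
        · simp only [Finset.mem_cons, hca, false_or, if_false, Set.mem_sdiff] at hc
          exact hu c ⟨hc.1, hc.2.1⟩
    · rintro x ⟨e, he, hxe⟩ c hc hxc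
      by_cases hca : c = a
      · simpa [hca] using hxc
      · simp only [Finset.mem_cons, hca, false_or, if_false, Set.mem_sdiff] at hc hxc
        refine hDB x ⟨e, ?_, hxe⟩ c hc hxc.1
        rcases Finset.mem_cons.1 he with rfl | he
        · exact (hxc.2 hxe).elim
        · exact he

variable [MetricSpace X] [CompactSpace X] [BorelSpace X]

/-- Membership in a finite family of measurable sets is locally constant up to a family of small
entropy. -/
lemma exists_ent_le_of_dist_lt (μ : Measure X) [IsProbabilityMeasure μ] (α : Finset (MSet X))
    {ε : ℝ} (hε : 0 < ε) :
    ∃ W : Finset (MSet X), ent μ W ≤ ε ∧ ∃ δ > 0, ∀ x y, dist x y < δ →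
      (∀ B ∈ W, x ∈ B.1 ↔ y ∈ B.1) → ∀ A ∈ α, x ∈ A.1 ↔ y ∈ A.1 := by
  have hH := isPolymatroid_ent μ
  induction α using Finset.induction_on generalizing ε with
  | empty => exact ⟨∅, by rw [hH.empty]; exact hε.le, 1, one_pos, by simp⟩
  | insert A α hA ih =>
    obtain ⟨W, hW, δ, hδ, h⟩ := ih (half_pos hε)
    obtain ⟨η, hη, hsmall⟩ := ent_singleton_small μ (show 0 < ε / 4 by positivity)
    have hη' : ENNReal.ofReal (η / 2) ≠ 0 := by simpa using hη
    obtain ⟨C, hCA, hC, hAC⟩ := A.2.exists_isClosed_sdiff_lt (measure_ne_top μ _) hη'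
    obtain ⟨O, hAO, hO, -, hOA⟩ := A.2.exists_isOpen_sdiff_lt (measure_ne_top μ _) hη'
    obtain ⟨δ', hδ', hCO⟩ := hC.isCompact.exists_thickening_subset_open hO (hCA.trans hAO)
    let P : MSet X := ⟨O \ C, hO.measurableSet.diff hC.measurableSet⟩
    let Q : MSet X := ⟨A.1 \ C, A.2.diff hC.measurableSet⟩
    have hP : μ P.1 < ENNReal.ofReal η := by
      have : P.1 ⊆ (O \ A.1) ∪ (A.1 \ C) := by
        rintro x ⟨hxO, hxC⟩
        by_cases hx : x ∈ A.1
        exacts [Or.inr ⟨hx, hxC⟩, Or.inl ⟨hxO, hx⟩]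
      refine (measure_mono this).trans_lt ((measure_union_le _ _).trans_lt ?_)
      refine (ENNReal.add_lt_add hOA hAC).trans_eq ?_
      rw [← ENNReal.ofReal_add (by positivity) (by positivity), add_halves]
    have hPr : μ.real P.1 < η := (ENNReal.lt_ofReal_iff_toReal_lt (measure_ne_top _ _)).1 hP
    have hQr : μ.real Q.1 < η :=
      (measureReal_mono (sdiff_subset_sdiff_left hAO)).trans_lt hPr
    refine ⟨({P} ∪ {Q}) ∪ W, ?_, min δ δ', lt_min hδ hδ', ?_⟩
    · have h1 := hH.union_le ({P} ∪ {Q}) W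
      have h2 := hH.union_le {P} {Q}
      linarith [hsmall P hPr, hsmall Q hQr]
    · have key : ∀ x y, dist x y < δ' → (∀ B ∈ ({P} ∪ {Q}) ∪ W, x ∈ B.1 ↔ y ∈ B.1) →
          x ∈ A.1 → y ∈ A.1 := by
        intro x y hxy hB hx
        have hPx : x ∈ O \ C ↔ y ∈ O \ C := hB P (by simp)
        have hQx : x ∈ A.1 \ C ↔ y ∈ A.1 \ C := hB Q (by simp)
        by_cases hxC : x ∈ C
        · have hyO : y ∈ O := hCO (Metric.mem_thickening_iff.2 ⟨x, hxC, by rwa [dist_comm]⟩)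
          by_contra hy
          exact (hPx.2 ⟨hyO, fun h => hy (hCA h)⟩).2 hxC
        · exact (hQx.1 ⟨hx, hxC⟩).1
      intro x y hxy hB B hBA
      rcases Finset.mem_insert.1 hBA with rfl | hBA
      · have h1 := hxy.trans_le (min_le_right δ δ')
        exact ⟨key x y h1 hB, key y x (by rwa [dist_comm]) fun C hC => (hB C hC).symm⟩
      · exact h x y (hxy.trans_le (min_le_left _ _))
          (fun C hC => hB C (Finset.mem_union_right _ hC)) B hBA

/-- The entropy of a measure supported by `K`, corrected by the entropy of a family `W` controlling
the discontinuities of `α`, is bounded by separated sums over `K`. -/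
theorem ent_blk_add_integral_le (T : X ≃ₜ X) (f : C(X, ℝ)) {α W : Finset (MSet X)} {δ η ω : ℝ}
    (hα : ∀ x y, dist x y < δ → (∀ B ∈ W, x ∈ B.1 ↔ y ∈ B.1) → ∀ A ∈ α, x ∈ A.1 ↔ y ∈ A.1)
    (hη : 0 < η) (hηδ : 2 * η < δ) (hω : ∀ x y, dist x y ≤ η → f x ≤ f y + ω) (n : ℕ)
    (ν : Measure X) [IsProbabilityMeasure ν] {K : Set X} (hK : ν Kᶜ = 0) :
    ent ν (blk (prePerm T.toMeasurableEquiv) α n) + ∫ x, birk T f n x ∂ν ≤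
      ent ν (blk (prePerm T.toMeasurableEquiv) W n) + log (sepPn T f n η K) + n * ω := by
  have hH := isPolymatroid_ent ν
  set τ := prePerm T.toMeasurableEquiv with hτ
  have hKne : K.Nonempty := by
    by_contra h
    simp [not_nonempty_iff_eq_empty.1 h] at hK
  have hKae : ∀ᵐ x ∂ν, x ∈ K := hK
  obtain ⟨E, hEK, hE, hspan⟩ := exists_isSep_spanning T n hη K
  have hEne : E.Nonempty := by
    obtain ⟨x, hx⟩ := hKne
    obtain ⟨e, he, -⟩ := hspan x hx
    exact ⟨e, he⟩
  have hTc : ∀ i, Continuous (T^[i]) := fun i => T.continuous.iterate i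
  let B : X → MSet X := fun e => ⟨{x | ∀ i < n, dist (T^[i] x) (T^[i] e) ≤ η}, by
    simp only [ofPred_forall]
    exact .iInter fun i => .iInter fun _ =>
      (isClosed_le ((hTc i).dist continuous_const) continuous_const).measurableSet⟩
  obtain ⟨D, hD, hDB⟩ := exists_partition hEne B
  have hDK : ∀ x ∈ K, ∀ e ∈ E, x ∈ (D e).1 → ∀ i < n, dist (T^[i] x) (T^[i] e) ≤ η :=
    fun x hx e he hxe => hDB x (hspan x hx) e he hxe
  have h1 : ent ν (blk τ α n) ≤ ent ν (blk τ W n) + ent ν (E.image D) := by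
    refine le_trans ?_ (hH.union_le _ _)
    set G := blk τ W n ∪ E.image D with hG
    have hadd : ∀ S ⊆ blk τ α n, ent ν (S ∪ G) = ent ν G := by
      intro S
      induction S using Finset.induction_on with
      | empty => simp
      | insert a S ha ih =>
        intro hS
        rw [Finset.insert_union, ← ih ((Finset.subset_insert _ _).trans hS)]
        refine ent_insert_eq_of_null ν fun R _ => ?_
        obtain ⟨i, hi, b, hb, rfl⟩ := mem_blk.1 (hS (Finset.mem_insert_self _ _))
        have hiff : ∀ x ∈ K, ∀ y ∈ K, x ∈ cell (S ∪ G) R → y ∈ cell (S ∪ G) R →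
            (x ∈ ((τ ^ i) b).1 ↔ y ∈ ((τ ^ i) b).1) := by
          intro x hx y hy hxR hyR
          have hxy : ∀ A ∈ G, x ∈ A.1 ↔ y ∈ A.1 := fun A hA =>
            (hxR A (Finset.mem_union_right _ hA)).trans (hyR A (Finset.mem_union_right _ hA)).symm
          rw [prePerm_pow_apply]
          refine hα _ _ ?_ (fun A hA => ?_) b hb
          · obtain ⟨e, ⟨he, hxe⟩, -⟩ := hD x
            have hye : y ∈ (D e).1 := (hxy (D e) (Finset.mem_union_right _
              (Finset.mem_image_of_mem _ he))).1 hxe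
            have hdx := hDK x hx e he hxe i hi
            have hdy := hDK y hy e he hye i hi
            have := dist_triangle_right (T^[i] x) (T^[i] y) (T^[i] e)
            exact (this.trans (by linarith)).trans_lt hηδ
          · have := hxy ((τ ^ i) A) (Finset.mem_union_left _ (mem_blk.2 ⟨i, hi, A, hA, rfl⟩))
            rwa [prePerm_pow_apply] at this
        by_cases hne : (K ∩ (cell (S ∪ G) R ∩ ((τ ^ i) b).1)).Nonempty
        · obtain ⟨x, hxK, hxR, hxb⟩ := hne
          refine Or.inr (measure_mono_null ?_ hK)
          rintro y ⟨hyR, hyb⟩ hyK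
          exact hyb ((hiff x hxK y hyK hxR hyR).1 hxb)
        · refine Or.inl (measure_mono_null ?_ hK)
          exact fun y hy hyK => hne ⟨y, hyK, hy⟩
    exact (hH.mono _ _ Finset.subset_union_left).trans (hadd _ Finset.Subset.rfl).le
  have h2 := ent_image_le_of_partition ν E D hD
  have hsum : ∑ e ∈ E, ν.real (D e).1 = 1 := by
    have hU : ⋃ e ∈ E, (D e).1 = univ := eq_univ_of_forall fun x => by
      obtain ⟨e, ⟨he, hx⟩, -⟩ := hD x
      exact mem_iUnion₂.2 ⟨e, he, hx⟩
    rw [← measureReal_biUnion_finset _ (fun e _ => (D e).2), hU, probReal_univ]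
    intro e he e' he' hne
    refine Set.disjoint_left.2 fun x hx hx' => hne ?_
    exact (hD x).unique ⟨he, hx⟩ ⟨he', hx'⟩
  have h3 : ∫ x, birk T f n x ∂ν ≤ ∑ e ∈ E, ν.real (D e).1 * (birk T f n e + n * ω) := by
    have hle : ∀ᵐ x ∂ν, birk T f n x ≤
        ∑ e ∈ E, (D e).1.indicator (fun _ => birk T f n e + n * ω) x := by
      filter_upwards [hKae] with x hx
      obtain ⟨e, ⟨he, hxe⟩, hu⟩ := hD x
      rw [Finset.sum_eq_single_of_mem e he fun c hc hce => indicator_of_notMem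
        (fun h => hce (hu c ⟨hc, h⟩)) _, indicator_of_mem hxe]
      calc birk T f n x ≤ ∑ j ∈ Finset.range n, (f (T^[j] e) + ω) :=
            Finset.sum_le_sum fun j hj => hω _ _ (hDK x hx e he hxe j (Finset.mem_range.1 hj))
        _ = _ := by simp [birk, Finset.sum_add_distrib]
    refine (integral_mono_ae ?_ ?_ hle).trans_eq ?_
    · have hc : Continuous (birk T f n) :=
        continuous_finsetSum _ fun j _ => f.continuous.comp (hTc j)
      exact hc.integrable_of_hasCompactSupport (HasCompactSupport.of_compactSpace _)
    · exact integrable_finsetSum _ fun e _ => (integrable_const _).indicator (D e).2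
    · rw [integral_finsetSum _ fun e _ => (integrable_const _).indicator (D e).2]
      exact Finset.sum_congr rfl fun e _ => by rw [integral_indicator_const _ (D e).2, smul_eq_mul]
  have h4 := sum_negMulLog_add_le_log_sum_exp E (fun e => ν.real (D e).1) (birk T f n)
    (fun _ _ => measureReal_nonneg) hsum
  have h5 : log (∑ e ∈ E, exp (birk T f n e)) ≤ log (sepPn T f n η K) :=
    log_le_log (Finset.sum_pos (fun _ _ => exp_pos _) hEne) (le_sepPn hη hEK hE)
  have h6 : ∑ e ∈ E, ν.real (D e).1 * (birk T f n e + n * ω) =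
      ∑ e ∈ E, ν.real (D e).1 * birk T f n e + n * ω := by
    simp only [mul_add, Finset.sum_add_distrib, ← Finset.sum_mul, hsum, one_mul]
  rw [Finset.sum_add_distrib] at h4
  linarith

end LocalEstimate

section ConditionalEntropy

open Classical Real ProbabilityTheory

lemma sum_measureReal_cell [MeasurableSpace X] (μ : Measure X) [IsFiniteMeasure μ]
    (S : Finset (MSet X)) (t : Set X) :
    ∑ R ∈ S.powerset, μ.real (cell S R ∩ t) = μ.real t := by
  have hU : ⋃ R ∈ S.powerset, cell S R = univ := eq_univ_of_forall fun x =>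
    mem_iUnion₂.2 ⟨_, Finset.mem_powerset.2 (Finset.filter_subset _ _), mem_cell_filter S x⟩
  have h := measureReal_biUnion_finset (μ := μ.restrict t) (s := S.powerset) (f := cell S)
    (fun R hR R' hR' hne =>
      cell_disjoint (Finset.mem_powerset.1 hR) (Finset.mem_powerset.1 hR') hne)
    (fun R _ => measurableSet_cell S R)
  rw [hU, measureReal_restrict_apply_univ] at h
  rw [h]
  exact Finset.sum_congr rfl fun R _ => by
    rw [measureReal_restrict_apply (measurableSet_cell S R)]

lemma sum_setIntegral_cell [MeasurableSpace X] {μ : Measure X} (S : Finset (MSet X)) {F : X → ℝ}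
    (hF : Integrable F μ) : ∑ R ∈ S.powerset, ∫ x in cell S R, F x ∂μ = ∫ x, F x ∂μ := by
  have hU : ⋃ R ∈ S.powerset, cell S R = univ := eq_univ_of_forall fun x =>
    mem_iUnion₂.2 ⟨_, Finset.mem_powerset.2 (Finset.filter_subset _ _), mem_cell_filter S x⟩
  rw [← integral_biUnion_finset _ (fun R _ => measurableSet_cell S R)
    (fun R hR R' hR' hne =>
      cell_disjoint (Finset.mem_powerset.1 hR) (Finset.mem_powerset.1 hR') hne)
    (fun _ _ => hF.integrableOn), hU, setIntegral_univ]

lemma ent_union_le_sum_cell [MeasurableSpace X] (μ : Measure X) [IsProbabilityMeasure μ]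
    (S W : Finset (MSet X)) :
    ent μ (S ∪ W) ≤ ∑ Q ∈ W.powerset, ∑ R ∈ S.powerset,
      negMulLog (μ.real (cell S R ∩ cell W Q)) := by
  rw [← Finset.sum_product']
  refine ent_le_sum_of_forall_exists_eq_cell μ _
    (fun p : Finset (MSet X) × Finset (MSet X) => cell S p.2 ∩ cell W p.1) _ fun x => ?_
  refine ⟨(W.filter fun A => x ∈ A.1, S.filter fun A => x ∈ A.1), by simp, ?_⟩
  ext y
  simp only [cell, mem_inter_iff, mem_ofPred_eq, Finset.mem_filter, Finset.mem_union]
  constructor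
  · rintro ⟨h1, h2⟩ A (hA | hA)
    · simpa [hA] using h1 A hA
    · simpa [hA] using h2 A hA
  · exact fun h => ⟨fun A hA => by simpa [hA] using h A (Or.inl hA),
      fun A hA => by simpa [hA] using h A (Or.inr hA)⟩

variable {m mX : MeasurableSpace X} [StandardBorelSpace X] {μ : Measure X}

lemma integrable_negMulLog_condExpKernel [IsFiniteMeasure μ] (hm : m ≤ mX) {s : Set X}
    (hs : MeasurableSet s) :
    Integrable (fun x => negMulLog ((condExpKernel μ m x).real s)) μ := by
  have hmeas : Measurable fun x => (condExpKernel μ m x).real s :=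
    ((measurable_condExpKernel hs).mono hm le_rfl).ennreal_toReal
  refine Integrable.of_bound (continuous_negMulLog.measurable.comp hmeas).aestronglyMeasurable 1
    (ae_of_all _ fun x => ?_)
  rw [Real.norm_of_nonneg (negMulLog_nonneg measureReal_nonneg measureReal_le_one)]
  have := negMulLog_add_mul_le (a := 0) (measureReal_nonneg (μ := condExpKernel μ m x) (s := s))
    one_pos
  have h0 : 0 ≤ (condExpKernel μ m x).real s := measureReal_nonneg
  simp only [mul_zero, add_zero, log_one, zero_add, exp_zero, div_one] at this
  linarith

lemma integrable_ent_condExpKernel [IsFiniteMeasure μ] (hm : m ≤ mX) (S : Finset (MSet X)) :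
    Integrable (fun x => ent (condExpKernel μ m x) S) μ :=
  integrable_finsetSum _ fun R _ => integrable_negMulLog_condExpKernel hm (measurableSet_cell S R)

lemma setIntegral_condExpKernel_real [IsFiniteMeasure μ] (hm : m ≤ mX) {s t : Set X}
    (hs : MeasurableSet s) (ht : MeasurableSet[m] t) :
    ∫ x in t, (condExpKernel μ m x).real s ∂μ = μ.real (s ∩ t) := by
  rw [measureReal_def, ← setLIntegral_condExpKernel hm hs ht, ← integral_toReal]
  · rfl
  · exact ((measurable_condExpKernel hs).mono hm le_rfl).aemeasurable
  · exact ae_of_all _ fun x => measure_lt_top _ _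

/-- Entropy is concave under disintegration. -/
lemma integral_ent_condExpKernel_le [IsProbabilityMeasure μ] (hm : m ≤ mX) (S : Finset (MSet X)) :
    ∫ x, ent (condExpKernel μ m x) S ∂μ ≤ ent μ S := by
  unfold ent
  rw [integral_finsetSum _ fun R _ =>
    integrable_negMulLog_condExpKernel hm (measurableSet_cell S R)]
  refine Finset.sum_le_sum fun R _ => ?_
  have h := setIntegral_condExpKernel_real (μ := μ) hm (measurableSet_cell S R)
    (@MeasurableSet.univ _ m)
  rw [inter_univ, setIntegral_univ] at h
  rw [← h]
  exact concaveOn_negMulLog.le_map_integral continuous_negMulLog.continuousOn isClosed_Ici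
    (ae_of_all _ fun x => measureReal_nonneg) (integrable_toReal_condExpKernel
      (measurableSet_cell S R)) (integrable_negMulLog_condExpKernel hm (measurableSet_cell S R))

/-- The conditional entropy is at most the average entropy of the conditional measures. -/
theorem condH_le_integral_ent_condExpKernel [IsProbabilityMeasure μ] (hm : m ≤ mX)
    {𝒵 : Set (MSet X)}
    (h𝒵 : ∀ A (hA : MeasurableSet A), MeasurableSet[m] A → (⟨A, hA⟩ : MSet X) ∈ clH (ent μ) 𝒵)
    (S : Finset (MSet X)) :
    condH (ent μ) S 𝒵 ≤ ∫ x, ent (condExpKernel μ m x) S ∂μ := by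
  have hH := isPolymatroid_ent μ
  refine le_of_forall_pos_le_add fun ε hε => ?_
  obtain ⟨c, hc⟩ : ∃ c : ℝ, c = (S.powerset.card : ℝ) := ⟨_, rfl⟩
  have hc0 : 0 < c := by
    rw [hc]; exact_mod_cast Finset.card_pos.2 (Finset.powerset_nonempty S)
  obtain ⟨δ, hδ, hφ⟩ := Metric.uniformContinuousOn_iff.1
    (isCompact_Icc.uniformContinuousOn_of_continuous
      (continuous_negMulLog.continuousOn (s := Icc 0 1))) (ε / c) (by positivity)
  obtain ⟨N, hN⟩ := exists_nat_one_div_lt hδ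
  set g : Finset (MSet X) → X → ℝ := fun R x => (condExpKernel μ m x).real (cell S R) with hg
  have hgm : ∀ R, Measurable[m] (g R) := fun R =>
    (measurable_condExpKernel (measurableSet_cell S R)).ennreal_toReal
  have hg0 : ∀ R x, 0 ≤ g R x := fun R x => measureReal_nonneg
  have hg1 : ∀ R x, g R x ≤ 1 := fun R x => measureReal_le_one
  have hlev : ∀ R (j : ℕ), MeasurableSet[m] {x | g R x < j / (N + 1)} := fun R j =>
    hgm R measurableSet_Iio
  let L : Finset (MSet X) × ℕ → MSet X := fun p =>
    ⟨{x | g p.1 x < p.2 / (N + 1)}, hm _ (hlev p.1 p.2)⟩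
  let W := (S.powerset ×ˢ Finset.range (N + 3)).image L
  have hWm : ∀ Q, MeasurableSet[m] (cell W Q) := by
    intro Q
    have hLm : ∀ A ∈ W, MeasurableSet[m] A.1 := by
      intro A hA
      obtain ⟨p, -, rfl⟩ := Finset.mem_image.1 hA
      exact hlev p.1 p.2
    have hcW : cell W Q = ⋂ A ∈ W, {x | x ∈ A.1 ↔ A ∈ Q} := by
      ext x
      simp [cell]
    rw [hcW]
    refine Finset.measurableSet_biInter _ fun A hA => ?_
    by_cases h : A ∈ Q
    · have : {x | x ∈ A.1 ↔ A ∈ Q} = A.1 := by ext; simp [h]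
      rw [this]; exact hLm A hA
    · have : {x | x ∈ A.1 ↔ A ∈ Q} = A.1ᶜ := by ext; simp [h]
      rw [this]; exact (hLm A hA).compl
  have hosc : ∀ R ∈ S.powerset, ∀ Q, ∀ x ∈ cell W Q, ∀ y ∈ cell W Q,
      g R y ≤ g R x + 1 / (N + 1) := by
    intro R hR Q x hx y hy
    have hN0 : (0 : ℝ) < N + 1 := by positivity
    set j := ⌊g R x * (N + 1)⌋₊ + 1 with hj
    have hxj : g R x < j / (N + 1) := by
      rw [lt_div_iff₀ hN0, hj]; push_cast; exact Nat.lt_floor_add_one _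
    have hjx : (j : ℝ) / (N + 1) ≤ g R x + 1 / (N + 1) := by
      rw [div_le_iff₀ hN0, add_mul, one_div_mul_cancel hN0.ne', hj]
      push_cast
      gcongr
      exact Nat.floor_le (mul_nonneg (hg0 R x) hN0.le)
    have hjN : j < N + 3 := by
      have : ⌊g R x * (N + 1)⌋₊ ≤ N + 1 := by
        refine Nat.floor_le_of_le ?_
        push_cast
        nlinarith [hg1 R x]
      omega
    have hL : L (R, j) ∈ W := Finset.mem_image_of_mem _
      (Finset.mem_product.2 ⟨hR, Finset.mem_range.2 hjN⟩)
    have hyj : g R y < j / (N + 1) := ((hx _ hL).trans (hy _ hL).symm).1 hxj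
    linarith
  have hWcl : (W : Set (MSet X)) ⊆ clH (ent μ) 𝒵 := by
    intro A hA
    obtain ⟨p, -, rfl⟩ := Finset.mem_image.1 (Finset.mem_coe.1 hA)
    exact h𝒵 _ _ (hlev p.1 p.2)
  have hcell : ∀ Q ∈ W.powerset,
      ∑ R ∈ S.powerset, negMulLog (μ.real (cell S R ∩ cell W Q)) - negMulLog (μ.real (cell W Q)) ≤
        ∫ x in cell W Q, ent (condExpKernel μ m x) S ∂μ + μ.real (cell W Q) * ε := by
    intro Q _
    set q := μ.real (cell W Q) with hq
    have hq0 : 0 ≤ q := measureReal_nonneg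
    have hint0 : 0 ≤ ∫ x in cell W Q, ent (condExpKernel μ m x) S ∂μ :=
      integral_nonneg fun x => Finset.sum_nonneg fun R _ =>
        negMulLog_nonneg measureReal_nonneg measureReal_le_one
    rcases hq0.eq_or_lt with h0 | hqpos
    · rw [← h0, Finset.sum_eq_zero]
      · simpa using hint0
      · intro R _
        rw [measureReal_mono_null inter_subset_right h0.symm, negMulLog_zero]
    · set p : Finset (MSet X) → ℝ := fun R => μ.real (cell S R ∩ cell W Q) / q with hp
      have hp' : ∀ R, μ.real (cell S R ∩ cell W Q) = q * p R := fun R => by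
        rw [hp]; field_simp
      have hpsum : ∑ R ∈ S.powerset, p R = 1 := by
        rw [hp, ← Finset.sum_div, sum_measureReal_cell, ← hq, div_self hqpos.ne']
      have hpint : ∀ R, q * p R = ∫ x in cell W Q, g R x ∂μ := fun R => by
        rw [← hp', setIntegral_condExpKernel_real hm (measurableSet_cell S R) (hWm Q)]
      have hgi : ∀ R, Integrable (g R) μ := fun R =>
        integrable_toReal_condExpKernel (measurableSet_cell S R)
      have hWX := hm _ (hWm Q)
      have hclose : ∀ R ∈ S.powerset, ∀ x ∈ cell W Q, |p R - g R x| ≤ 1 / (N + 1) := by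
        intro R hR x hx
        have h1 : q * p R ≤ q * (g R x + 1 / (N + 1)) := by
          rw [hpint]
          refine (setIntegral_mono_on (hgi R).integrableOn (integrable_const _).integrableOn hWX
            fun y hy => hosc R hR Q x hx y hy).trans_eq ?_
          rw [setIntegral_const, smul_eq_mul]
        have h2 : q * (g R x - 1 / (N + 1)) ≤ q * p R := by
          rw [hpint]
          refine le_trans (le_of_eq ?_) (setIntegral_mono_on (integrable_const _).integrableOn
            (hgi R).integrableOn hWX fun y hy => sub_le_iff_le_add.2 (hosc R hR Q y hy x hx))
          rw [setIntegral_const, smul_eq_mul]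
        have h1' := le_of_mul_le_mul_left h1 hqpos
        have h2' := le_of_mul_le_mul_left h2 hqpos
        rw [abs_le]
        constructor <;> linarith
      have hp01 : ∀ R, p R ∈ Icc (0 : ℝ) 1 := fun R =>
        ⟨div_nonneg measureReal_nonneg hq0, div_le_one_of_le₀ (measureReal_mono inter_subset_right)
          hq0⟩
      have hφ' : ∀ R ∈ S.powerset, ∀ x ∈ cell W Q,
          negMulLog (p R) ≤ negMulLog (g R x) + ε / c := by
        intro R hR x hx
        have := hφ (p R) (hp01 R) (g R x) ⟨hg0 R x, hg1 R x⟩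
          ((hclose R hR x hx).trans_lt hN)
        linarith [(abs_lt.1 this).2]
      have hent : ∫ x in cell W Q, ent (condExpKernel μ m x) S ∂μ =
          ∑ R ∈ S.powerset, ∫ x in cell W Q, negMulLog (g R x) ∂μ :=
        integral_finsetSum _ fun R _ =>
          (integrable_negMulLog_condExpKernel hm (measurableSet_cell S R)).integrableOn
      have hterm : ∀ R ∈ S.powerset, q * negMulLog (p R) ≤
          ∫ x in cell W Q, negMulLog (g R x) ∂μ + q * (ε / c) := by
        intro R hR
        have hi := (integrable_negMulLog_condExpKernel (μ := μ) hm (measurableSet_cell S R))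
        have h := setIntegral_mono_on (μ := μ) (s := cell W Q) (f := fun _ => negMulLog (p R))
          (g := fun x => negMulLog (g R x) + ε / c) (integrable_const _).integrableOn
          (hi.add (integrable_const _)).integrableOn hWX (hφ' R hR)
        rw [setIntegral_const, smul_eq_mul, integral_add hi.integrableOn
          (integrable_const _).integrableOn, setIntegral_const, smul_eq_mul] at h
        exact h
      have hlhs : ∑ R ∈ S.powerset, negMulLog (μ.real (cell S R ∩ cell W Q)) - negMulLog q =
          ∑ R ∈ S.powerset, q * negMulLog (p R) := by
        simp only [hp', negMulLog_mul, Finset.sum_add_distrib, ← Finset.sum_mul, hpsum]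
        ring
      rw [hlhs, hent]
      refine (Finset.sum_le_sum hterm).trans_eq ?_
      rw [Finset.sum_add_distrib, Finset.sum_const, nsmul_eq_mul, ← hc]
      field_simp
  calc condH (ent μ) S 𝒵 = condH (ent μ) S (clH (ent μ) 𝒵) := (hH.condH_clH _ _).symm
    _ ≤ ent μ (S ∪ W) - ent μ W := hH.condH_le _ hWcl
    _ ≤ ∑ Q ∈ W.powerset, (∑ R ∈ S.powerset, negMulLog (μ.real (cell S R ∩ cell W Q)) -
          negMulLog (μ.real (cell W Q))) := by
        rw [Finset.sum_sub_distrib]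
        exact sub_le_sub_right (ent_union_le_sum_cell μ S W) _
    _ ≤ ∑ Q ∈ W.powerset, (∫ x in cell W Q, ent (condExpKernel μ m x) S ∂μ +
          μ.real (cell W Q) * ε) := Finset.sum_le_sum hcell
    _ = _ := by
        have h1 := sum_measureReal_cell μ W univ
        simp only [inter_univ, probReal_univ] at h1
        rw [Finset.sum_add_distrib, sum_setIntegral_cell W (integrable_ent_condExpKernel hm S),
          ← Finset.sum_mul, h1, one_mul]

end ConditionalEntropy

section PinskerPressure

open Classical Real ProbabilityTheory

lemma IsPolymatroid.rank_blk_le_mul {M : Type*} {H : Finset M → ℝ} {τ : Equiv.Perm M}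
    (hH : IsPolymatroid H) (hτ : ∀ S : Finset M, H (S.image τ) = H S) (S : Finset M) (n : ℕ) :
    H (blk τ S n) ≤ n * H S := by
  induction n with
  | zero => simp [blk_zero, hH.empty]
  | succ n ih =>
    rw [blk_succ]
    refine (hH.union_le _ _).trans ?_
    rw [hτ]
    push_cast
    linarith

lemma card_blk_le {M : Type*} (τ : Equiv.Perm M) (S : Finset M) (n : ℕ) :
    (blk τ S n).card ≤ n * S.card := by
  refine Finset.card_biUnion_le.trans ?_
  refine (Finset.sum_le_card_nsmul _ _ S.card fun i _ => Finset.card_image_le).trans_eq ?_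
  simp

lemma ent_nonneg [MeasurableSpace X] (ν : Measure X) [IsProbabilityMeasure ν]
    (S : Finset (MSet X)) : 0 ≤ ent ν S :=
  Finset.sum_nonneg fun _ _ => negMulLog_nonneg measureReal_nonneg measureReal_le_one

lemma ent_blk_le_card [MeasurableSpace X] (τ : Equiv.Perm (MSet X)) (ν : Measure X)
    [IsProbabilityMeasure ν] (S : Finset (MSet X)) (n : ℕ) :
    ent ν (blk τ S n) ≤ n * (S.card * log 2) := by
  refine (ent_le_card ν _).trans ?_
  rw [← mul_assoc]
  refine mul_le_mul_of_nonneg_right ?_ (log_nonneg one_le_two)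
  exact_mod_cast card_blk_le τ S n

/-- A bounded sequence of functions whose integrals are at least `b` exceeds each `a < b`
infinitely often on a set of positive measure. -/
lemma exists_frequently_lt_of_le_integral [MeasurableSpace X] {μ : Measure X}
    [IsProbabilityMeasure μ] {g : ℕ → X → ℝ} {M a b : ℝ} (hg : ∀ n, Integrable (g n) μ)
    (hM : ∀ n x, |g n x| ≤ M) (hb : ∀ᶠ n in atTop, b ≤ ∫ x, g n x ∂μ) (hab : a < b)
    {p : X → Prop} (hp : ∀ᵐ x ∂μ, p x) : ∃ x, p x ∧ ∃ᶠ n in atTop, a < g n x := by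
  by_contra! h
  have hlim : ∀ᵐ x ∂μ, Tendsto (fun n => max (g n x) a) atTop (𝓝 a) := by
    filter_upwards [hp] with x hx
    refine tendsto_const_nhds.congr' ?_
    filter_upwards [h x hx] with n hn
    exact (max_eq_right hn).symm
  have hgi : ∀ n, Integrable (fun x => max (g n x) a) μ := fun n =>
    (hg n).sup (integrable_const a)
  have ht := tendsto_integral_of_dominated_convergence (fun _ => max M |a|)
    (fun n => (hgi n).aestronglyMeasurable) (integrable_const _)
    (fun n => ae_of_all _ fun x => abs_max_le_max_abs_abs.trans (max_le_max_right _ (hM n x)))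
    hlim
  rw [integral_const, probReal_univ, one_smul] at ht
  refine hab.not_ge (ge_of_tendsto ht ?_)
  filter_upwards [hb] with n hn
  exact hn.trans (integral_mono (hg n) (hgi n) fun x => le_max_left _ _)

lemma measurable_birk [MetricSpace X] [MeasurableSpace X] [BorelSpace X] (T : X ≃ₜ X)
    (f : C(X, ℝ)) (n : ℕ) : Measurable (birk T f n) :=
  Finset.measurable_sum _ fun j _ => f.continuous.measurable.comp (T.measurable.iterate j)

/-- The pressure of a set supporting infinitely many large values of the local free energy. -/
lemma le_pres_of_frequently [MetricSpace X] (T : X → X) (f : X → ℝ) {K : Set X} {η c : ℝ}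
    (hη : 0 < η) (h : ∃ᶠ n : ℕ in atTop, c ≤ log (sepPn T f n η K) / n) :
    (c : EReal) ≤ pres T f K :=
  (le_limsup_of_frequently_le (h.mono fun _ hn => EReal.coe_le_coe_iff.2 hn)).trans
    (le_iSup₂_of_le η hη le_rfl)

variable [MetricSpace X] [CompactSpace X]

lemma integrable_birk [MeasurableSpace X] [BorelSpace X] (T : X ≃ₜ X) (f : C(X, ℝ)) (n : ℕ)
    (ν : Measure X) [IsFiniteMeasure ν] : Integrable (birk T f n) ν :=
  .of_bound (measurable_birk T f n).aestronglyMeasurable _ (ae_of_all _ (abs_birk_le T f n))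

lemma integral_birk [MeasurableSpace X] [BorelSpace X] {T : X ≃ₜ X} {μ : Measure X}
    [IsFiniteMeasure μ] (hT : μ.map T = μ) (f : C(X, ℝ)) (n : ℕ) :
    ∫ x, birk T f n x ∂μ = n * ∫ x, f x ∂μ := by
  have hmp : MeasurePreserving T μ μ := ⟨T.measurable, hT⟩
  have hf : Measurable f := f.continuous.measurable
  have hfi : ∀ j, Integrable (fun x => f (T^[j] x)) μ := fun j =>
    .of_bound (hf.comp (T.measurable.iterate j)).aestronglyMeasurable ‖f‖
      (ae_of_all _ fun x => f.norm_coe_le_norm _)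
  unfold birk
  rw [integral_finsetSum _ fun j _ => hfi j, Finset.sum_congr rfl fun j _ => ?_, Finset.sum_const,
    Finset.card_range, nsmul_eq_mul]
  conv_rhs => rw [← (hmp.iterate j).map_eq]
  rw [integral_map (T.measurable.iterate j).aemeasurable hf.aestronglyMeasurable]

lemma integral_integral_condExpKernel {m mX : MeasurableSpace X} [StandardBorelSpace X]
    {μ : Measure X} [IsFiniteMeasure μ] (hm : m ≤ mX) {F : X → ℝ} (hF : Integrable F μ) :
    ∫ x, ∫ y, F y ∂condExpKernel μ m x ∂μ = ∫ x, F x ∂μ := by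
  rw [← integral_condExp hm (f := F)]
  exact integral_congr_ae (condExp_ae_eq_integral_condExpKernel hm hF).symm

theorem exists_le_pres_closure_inter_closure [Nonempty X] (T : X ≃ₜ X) (f : C(X, ℝ)) {c : ℝ}
    (hc : (c : EReal) < pres T f univ) :
    ∃ x, (c : EReal) ≤ pres T f (closure (stableSet T x) ∩ closure (stableSet T.symm x)) := by
  let _ : MeasurableSpace X := borel X
  have : BorelSpace X := ⟨rfl⟩
  obtain ⟨c', hcc', hc'⟩ := EReal.lt_iff_exists_real_btwn.1 hc
  have hcc : c < c' := EReal.coe_lt_coe_iff.1 hcc'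
  obtain ⟨μ, hμ, hT, α, hα⟩ := exists_le_rate_add_integral T f hc'
  obtain ⟨ε, hε, hεc⟩ : ∃ ε > 0, c' = c + 4 * ε := ⟨(c' - c) / 4, by linarith, by ring⟩
  obtain ⟨W, hW, δ, hδ, hαW⟩ := exists_ent_le_of_dist_lt μ α hε
  obtain ⟨ρ, hρ, hfρ⟩ := Metric.uniformContinuous_iff.1
    (CompactSpace.uniformContinuous_of_continuous f.continuous) ε hε
  obtain ⟨η, hη, hηδ, hηρ⟩ : ∃ η > 0, 2 * η < δ ∧ η < ρ :=
    ⟨min (δ / 4) (ρ / 2), by positivity, by linarith [min_le_left (δ / 4) (ρ / 2)],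
      by linarith [min_le_right (δ / 4) (ρ / 2)]⟩
  have hω : ∀ x y, dist x y ≤ η → f x ≤ f y + ε := fun x y hxy => by
    have := (abs_lt.1 (hfρ (hxy.trans_lt hηρ))).2
    linarith
  have hm := pinsker_le (μ := μ) T
  have hH := isPolymatroid_ent μ
  have hτ := ent_image_eq_of_map_eq (T := T.toMeasurableEquiv) hT
  set τ := prePerm T.toMeasurableEquiv with hτdef
  let κ := condExpKernel μ (pinsker μ T)
  let g : ℕ → X → ℝ := fun n x =>
    (ent (κ x) (blk τ α n) - ent (κ x) (blk τ W n) + ∫ y, birk T f n y ∂κ x) / n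
  have hαi : ∀ n, Integrable (fun x => ent (κ x) (blk τ α n)) μ := fun n =>
    integrable_ent_condExpKernel hm _
  have hWi : ∀ n, Integrable (fun x => ent (κ x) (blk τ W n)) μ := fun n =>
    integrable_ent_condExpKernel hm _
  have hBi : ∀ n, Integrable (fun x => ∫ y, birk T f n y ∂κ x) μ := fun n =>
    (integrable_birk T f n μ).integral_condExpKernel
  have hg : ∀ n, Integrable (g n) μ := fun n => (((hαi n).sub (hWi n)).add (hBi n)).div_const _
  have hgM : ∀ n x, |g n x| ≤ α.card * log 2 + W.card * log 2 + ‖f‖ := by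
    intro n x
    have h1 := ent_blk_le_card τ (κ x) α n
    have h2 := ent_blk_le_card τ (κ x) W n
    have h3 := ent_nonneg (κ x) (blk τ α n)
    have h4 := ent_nonneg (κ x) (blk τ W n)
    have h5 : |∫ y, birk T f n y ∂κ x| ≤ n * ‖f‖ := by
      have hle : ∀ᵐ y ∂κ x, ‖birk T f n y‖ ≤ n * ‖f‖ := ae_of_all _ (abs_birk_le T f n)
      simpa using norm_integral_le_of_norm_le_const hle
    have hlog : 0 ≤ log 2 := log_nonneg one_le_two
    rw [abs_div, Nat.abs_cast]
    refine div_le_of_le_mul₀ n.cast_nonneg (by positivity) ?_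
    rw [abs_le] at h5 ⊢
    constructor <;> nlinarith
  have hgint : ∀ᶠ n in atTop, c' - ε ≤ ∫ x, g n x ∂μ := by
    filter_upwards [eventually_gt_atTop 0] with n hn
    have hn : (0 : ℝ) < n := Nat.cast_pos.2 hn
    have h1 : n * rate (ent μ) τ α ≤ ∫ x, ent (κ x) (blk τ α n) ∂μ :=
      (hH.mul_rate_le_condH hτ α n).trans
        (condH_le_integral_ent_condExpKernel hm (fun A hA h => h.2) _)
    have h2 : ∫ x, ent (κ x) (blk τ W n) ∂μ ≤ n * ε :=
      (integral_ent_condExpKernel_le hm _).trans ((hH.rank_blk_le_mul hτ W n).trans (by gcongr))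
    have h3 : ∫ x, ∫ y, birk T f n y ∂κ x ∂μ = n * ∫ x, f x ∂μ := by
      rw [← integral_birk hT]
      exact integral_integral_condExpKernel hm (integrable_birk T f n μ)
    have h4 : ∫ x, g n x ∂μ = (∫ x, ent (κ x) (blk τ α n) ∂μ - ∫ x, ent (κ x) (blk τ W n) ∂μ +
        ∫ x, ∫ y, birk T f n y ∂κ x ∂μ) / n := by
      rw [← integral_sub' (hαi n) (hWi n), ← integral_add' ((hαi n).sub (hWi n)) (hBi n),
        ← integral_div]
      rfl
    rw [h4, h3, le_div_iff₀ hn]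
    nlinarith
  obtain ⟨x, hx, hfreq⟩ := exists_frequently_lt_of_le_integral hg hgM hgint
    (show c' - 2 * ε < c' - ε by linarith) (ae_condExpKernel_closure_inter_closure hT)
  refine ⟨x, le_pres_of_frequently T f hη ?_⟩
  refine (hfreq.and_eventually (eventually_gt_atTop 0)).mono fun n ⟨hn, hn0⟩ => ?_
  have hn0 : (0 : ℝ) < n := Nat.cast_pos.2 hn0
  have h := ent_blk_add_integral_le T f hαW hη hηδ hω n (κ x) hx
  have hn' : (c' - 2 * ε) * n < ent (κ x) (blk τ α n) - ent (κ x) (blk τ W n) +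
      ∫ y, birk T f n y ∂κ x := (lt_div_iff₀ hn0).1 hn
  rw [le_div_iff₀ hn0]
  rw [← hτdef] at h
  nlinarith

end PinskerPressure

/-- For a TDS `(X,T)` and `f ∈ C(X,ℝ)`:
`sup_{x∈X} P(T,f, cl(W^s(x,T)) ∩ cl(W^u(x,T))) = P(T,f)`. -/
theorem stmt13 [MetricSpace X] [CompactSpace X] [Nonempty X]
    (T : X ≃ₜ X) (f : C(X, ℝ)) :
    (⨆ x : X, pres ⇑T ⇑f (closure (stableSet ⇑T x) ∩ closure (stableSet ⇑T.symm x))) =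
      pres ⇑T ⇑f Set.univ := by
  have hmem : ∀ (S : X → X) (x : X), x ∈ closure (stableSet S x) := fun S x =>
    subset_closure (by simp [stableSet])
  refine le_antisymm (iSup_le fun x => pres_mono T f ⟨x, hmem T x, hmem T.symm x⟩ (subset_univ _))
    (EReal.ge_of_forall_gt_iff_ge.1 fun c hc => ?_)
  obtain ⟨x, hx⟩ := exists_le_pres_closure_inter_closure T f hc
  exact le_iSup_of_le x hx
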